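/- arXiv:1504.08176 — 2 statements merged into one kernel-verified Lean document; each statement's English description precedes it below -/
import Mathlib

section
/- Suppose R is Henselian. Let M be a finitely generated R-module and let 0 → M → X⁰ → X¹ → ⋯ and 0 → M → X'⁰ → X'¹ → ⋯ be two special proper CM-coresolutions of M, with induced maps μ^i : coker d^{i−1} → X^i and μ'^i : coker d'^{i−1} → X'^i. Then for each i one has ker μ^i ≅ ker μ'^i. -/
open CategoryTheory

noncomputable section

/-- `Ext^n_A(M, N)` as a module. -/
def ext1 (A : Type) [CommRing A] (n : ℕ) (M N : Type) [AddCommGroup M] [Module A M]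
    [AddCommGroup N] [Module A N] : ModuleCat A :=
  ((Ext A (ModuleCat A) n).obj (Opposite.op (ModuleCat.of A M))).obj (ModuleCat.of A N)

/-- The depth of a module over a local ring: the least `n` with `Ext^n(k, M) ≠ 0`
(`⊤` if no such `n`, e.g. for the zero module). -/
def rdepth (A : Type) [CommRing A] [IsLocalRing A] (M : Type) [AddCommGroup M] [Module A M] :
    ℕ∞ :=
  sInf {n : ℕ∞ | ∃ m : ℕ, n = m ∧ ¬ Subsingleton (ext1 A m (IsLocalRing.ResidueField A) M)}

/-- The dimension of a module, `dim M = dim (A / ann M)`. -/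
def mdim (A : Type) [CommRing A] (M : Type) [AddCommGroup M] [Module A M] : WithBot ℕ∞ :=
  ringKrullDim (A ⧸ Module.annihilator A M)

/-- `cod M > n`, i.e. `dim A - dim M > n`, i.e. `dim M + n < d`. -/
def codGT (A : Type) [CommRing A] (d : ℕ) (M : Type) [AddCommGroup M] [Module A M]
    (n : ℕ) : Prop :=
  mdim A M + n < (d : WithBot ℕ∞)

/-- `cod M ≥ n`, i.e. `dim M + n ≤ d`. -/
def codGE (A : Type) [CommRing A] (d : ℕ) (M : Type) [AddCommGroup M] [Module A M]
    (n : ℕ) : Prop :=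
  mdim A M + n ≤ (d : WithBot ℕ∞)

/-- Maximal Cohen-Macaulay module over a `d`-dimensional local ring
(the zero module counts as MCM). -/
def IsMCM (A : Type) [CommRing A] [IsLocalRing A] (d : ℕ) (M : Type) [AddCommGroup M]
    [Module A M] : Prop :=
  Module.Finite A M ∧ (d : ℕ∞) ≤ rdepth A M

/-- Serre's condition `(S_n)`: `depth M_p ≥ min {n, ht p}` for all primes `p`. -/
def SerreS (A : Type) [CommRing A] (n : ℕ) (M : Type) [AddCommGroup M] [Module A M] : Prop :=
  ∀ p : PrimeSpectrum A,
    min (n : WithBot ℕ∞) (ringKrullDim (Localization.AtPrime p.asIdeal))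
      ≤ (rdepth (Localization.AtPrime p.asIdeal)
          (LocalizedModule p.asIdeal.primeCompl M) : ℕ∞)

/-- Finite injective dimension: `Ext^m(-, M)` vanishes for all large `m`. -/
def HasFID (A : Type) [CommRing A] (M : Type) [AddCommGroup M] [Module A M] : Prop :=
  ∃ n : ℕ, ∀ (N : Type) [AddCommGroup N] [Module A N], ∀ m : ℕ, n < m →
    Subsingleton (ext1 A m N M)

/-- `ω` is a canonical module of the `d`-dimensional local ring `A`:
it is maximal Cohen-Macaulay, of finite injective dimension, and of type one. -/
def IsCanonicalModule (A : Type) [CommRing A] [IsLocalRing A] (d : ℕ) (ω : Type)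
    [AddCommGroup ω] [Module A ω] : Prop :=
  IsMCM A d ω ∧ HasFID A ω ∧
    Nonempty ((ext1 A d (IsLocalRing.ResidueField A) ω) ≃ₗ[A] IsLocalRing.ResidueField A)

/-- `μ : M → X` is a CM-preenvelope. -/
def IsCMPreenvelope (A : Type) [CommRing A] [IsLocalRing A] (d : ℕ) {M X : Type}
    [AddCommGroup M] [Module A M] [AddCommGroup X] [Module A X] (μ : M →ₗ[A] X) : Prop :=
  IsMCM A d X ∧ ∀ (Z : Type) [AddCommGroup Z] [Module A Z], IsMCM A d Z →
    ∀ f : M →ₗ[A] Z, ∃ g : X →ₗ[A] Z, g ∘ₗ μ = f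

/-- `μ : M → X` is a special CM-preenvelope: a CM-preenvelope with
`Ext^1(coker μ, Z) = 0` for all maximal Cohen-Macaulay `Z`. -/
def IsSpecialCMPreenvelope (A : Type) [CommRing A] [IsLocalRing A] (d : ℕ) {M X : Type}
    [AddCommGroup M] [Module A M] [AddCommGroup X] [Module A X] (μ : M →ₗ[A] X) : Prop :=
  IsCMPreenvelope A d μ ∧ ∀ (Z : Type) [AddCommGroup Z] [Module A Z], IsMCM A d Z →
    Subsingleton (ext1 A 1 (X ⧸ LinearMap.range μ) Z)

/-- `μ : M → X` is a CM-envelope. -/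
def IsCMEnvelope (A : Type) [CommRing A] [IsLocalRing A] (d : ℕ) {M X : Type}
    [AddCommGroup M] [Module A M] [AddCommGroup X] [Module A X] (μ : M →ₗ[A] X) : Prop :=
  IsCMPreenvelope A d μ ∧ ∀ φ : X →ₗ[A] X, φ ∘ₗ μ = μ → Function.Bijective φ

/-- `π : X → M` is a CM-precover. -/
def IsCMPrecover (A : Type) [CommRing A] [IsLocalRing A] (d : ℕ) {X M : Type}
    [AddCommGroup X] [Module A X] [AddCommGroup M] [Module A M] (π : X →ₗ[A] M) : Prop :=
  IsMCM A d X ∧ ∀ (Z : Type) [AddCommGroup Z] [Module A Z], IsMCM A d Z →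
    ∀ f : Z →ₗ[A] M, ∃ g : Z →ₗ[A] X, π ∘ₗ g = f

/-- `π : X → M` is a special CM-precover: a CM-precover with
`Ext^1(Z, ker π) = 0` for all maximal Cohen-Macaulay `Z`. -/
def IsSpecialCMPrecover (A : Type) [CommRing A] [IsLocalRing A] (d : ℕ) {X M : Type}
    [AddCommGroup X] [Module A X] [AddCommGroup M] [Module A M] (π : X →ₗ[A] M) : Prop :=
  IsCMPrecover A d π ∧ ∀ (Z : Type) [AddCommGroup Z] [Module A Z], IsMCM A d Z →
    Subsingleton (ext1 A 1 Z ↥(LinearMap.ker π))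

/-- `π : X → M` is a CM-cover. -/
def IsCMCover (A : Type) [CommRing A] [IsLocalRing A] (d : ℕ) {X M : Type}
    [AddCommGroup X] [Module A X] [AddCommGroup M] [Module A M] (π : X →ₗ[A] M) : Prop :=
  IsCMPrecover A d π ∧ ∀ φ : X →ₗ[A] X, π ∘ₗ φ = π → Function.Bijective φ

/-- `M` has no nonzero free direct summand. -/
def NoNonzeroFreeSummand (A : Type) [CommRing A] (M : Type) [AddCommGroup M]
    [Module A M] : Prop :=
  ∀ F G : Submodule A M, IsCompl F G → Module.Free A ↥F → F = ⊥

/-- `W` belongs to `add ω`: it is a direct summand of a finite direct sum of copies of `ω`. -/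
def InAdd (A : Type) [CommRing A] (ω : Type) [AddCommGroup ω] [Module A ω] (W : Type)
    [AddCommGroup W] [Module A W] : Prop :=
  ∃ (n : ℕ) (W' : ModuleCat.{0} A), Nonempty ((W × ↥W') ≃ₗ[A] (Fin n → ω))

section delta

variable (A : Type) [CommRing A] (ω : Type) [AddCommGroup ω] [Module A ω]

/-- The natural evaluation map `δ_M : M → M†† = Hom(Hom(M, ω), ω)`. -/
def deltaMap (M : Type) [AddCommGroup M] [Module A M] :
    M →ₗ[A] ((M →ₗ[A] ω) →ₗ[A] ω) :=
  (LinearMap.id : (M →ₗ[A] ω) →ₗ[A] (M →ₗ[A] ω)).flip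

/-- The dual `f† = Hom(f, ω)` of a linear map `f`. -/
def dmap {M N : Type} [AddCommGroup M] [Module A M] [AddCommGroup N] [Module A N]
    (f : M →ₗ[A] N) : (N →ₗ[A] ω) →ₗ[A] (M →ₗ[A] ω) :=
  LinearMap.lcomp A ω f

end delta

/-- The homology `ker g / im f` at the middle spot of `M → N → P`. -/
abbrev homMod (A : Type) [CommRing A] {M N P : Type} [AddCommGroup M] [Module A M]
    [AddCommGroup N] [Module A N] [AddCommGroup P] [Module A P]
    (f : M →ₗ[A] N) (g : N →ₗ[A] P) : Type :=
  ↥(LinearMap.ker g) ⧸ Submodule.comap (LinearMap.ker g).subtype (LinearMap.range f)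

end

noncomputable section Coresolution

variable (R : Type) [CommRing R] [IsLocalRing R]
  (M : Type) [AddCommGroup M] [Module R M]
  (X : ℕ → ModuleCat.{0} R)
  (d0 : M →ₗ[R] ↥(X 0)) (dn : ∀ i, ↥(X i) →ₗ[R] ↥(X (i+1)))

/-- `coker d^{i-1}`, the source of the induced map `μ^i` (for `i = 0` it is `M`). -/
def cokerAt : ℕ → Type
  | 0 => M
  | 1 => ↥(X 0) ⧸ LinearMap.range d0
  | (i+2) => ↥(X (i+1)) ⧸ LinearMap.range (dn i)

instance cokerAtAddCommGroup : ∀ i, AddCommGroup (cokerAt R M X d0 dn i)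
  | 0 => inferInstanceAs (AddCommGroup M)
  | 1 => inferInstanceAs (AddCommGroup (↥(X 0) ⧸ LinearMap.range d0))
  | (i+2) => inferInstanceAs (AddCommGroup (↥(X (i+1)) ⧸ LinearMap.range (dn i)))

instance cokerAtModule : ∀ i, Module R (cokerAt R M X d0 dn i)
  | 0 => inferInstanceAs (Module R M)
  | 1 => inferInstanceAs (Module R (↥(X 0) ⧸ LinearMap.range d0))
  | (i+2) => inferInstanceAs (Module R (↥(X (i+1)) ⧸ LinearMap.range (dn i)))

variable (hc0 : LinearMap.range d0 ≤ LinearMap.ker (dn 0))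
  (hc : ∀ i, LinearMap.range (dn i) ≤ LinearMap.ker (dn (i+1)))

/-- The induced map `μ^i : coker d^{i-1} → X^i`. -/
def muAt : ∀ i, cokerAt R M X d0 dn i →ₗ[R] ↥(X i)
  | 0 => d0
  | 1 => Submodule.liftQ _ (dn 0) hc0
  | (i+2) => Submodule.liftQ _ (dn (i+1)) (hc i)

/-- The complex `0 → M → X⁰ → X¹ → ⋯` of maximal Cohen-Macaulay modules is a special
proper CM-coresolution of `M` if every induced map `μ^i` is a special CM-preenvelope. -/
def IsSpecialProperCMCoresolution (d : ℕ) : Prop :=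
  (∀ i, IsMCM R d ↥(X i)) ∧ ∀ i, IsSpecialCMPreenvelope R d (muAt R M X d0 dn hc0 hc i)

/-- The complex `0 → M → X⁰ → X¹ → ⋯` of maximal Cohen-Macaulay modules is a minimal
proper CM-coresolution of `M` if every induced map `μ^i` is a CM-envelope. -/
def IsMinimalProperCMCoresolution (d : ℕ) : Prop :=
  (∀ i, IsMCM R d ↥(X i)) ∧ ∀ i, IsCMEnvelope R d (muAt R M X d0 dn hc0 hc i)

end Coresolution

noncomputable section

section Preenvelope

variable {A : Type} [CommRing A]

/-- Two maps `ν`, `ν'` out of the same module that factor through each other satisfy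
`coker ν × Y' ≃ coker ν' × Y`. -/
def cokerProdEquiv {N Y Y' : Type} [AddCommGroup N] [Module A N] [AddCommGroup Y] [Module A Y]
    [AddCommGroup Y'] [Module A Y'] (ν : N →ₗ[A] Y) (ν' : N →ₗ[A] Y')
    (g : Y →ₗ[A] Y') (h : Y' →ₗ[A] Y) (hg : g ∘ₗ ν = ν') (hh : h ∘ₗ ν' = ν) :
    ((Y ⧸ LinearMap.range ν) × Y') ≃ₗ[A] ((Y' ⧸ LinearMap.range ν') × Y) :=
  LinearEquiv.ofLinearMap
    (LinearMap.coprod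
      (Submodule.liftQ (LinearMap.range ν)
        (((LinearMap.range ν').mkQ ∘ₗ g).prod (LinearMap.id - h ∘ₗ g)) (by
          rintro _ ⟨n, rfl⟩
          have h1 : g (ν n) = ν' n := LinearMap.congr_fun hg n
          have h2 : h (ν' n) = ν n := LinearMap.congr_fun hh n
          simp [h1, h2]))
      ((LinearMap.range ν').mkQ.prod (-h)))
    (LinearMap.coprod
      (Submodule.liftQ (LinearMap.range ν')
        (((LinearMap.range ν).mkQ ∘ₗ h).prod (LinearMap.id - g ∘ₗ h)) (by
          rintro _ ⟨n, rfl⟩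
          have h1 : g (ν n) = ν' n := LinearMap.congr_fun hg n
          have h2 : h (ν' n) = ν n := LinearMap.congr_fun hh n
          simp [h1, h2]))
      ((LinearMap.range ν).mkQ.prod (-g)))
    (by ext x <;> simp)
    (by ext x <;> simp)

/-- Adding an identity map does not change the cokernel. -/
def cokerProdMapIdEquiv {M X : Type} (Z : Type) [AddCommGroup M] [Module A M] [AddCommGroup X]
    [Module A X] [AddCommGroup Z] [Module A Z] (μ : M →ₗ[A] X) :
    ((X × Z) ⧸ LinearMap.range (μ.prodMap (LinearMap.id : Z →ₗ[A] Z))) ≃ₗ[A]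
      (X ⧸ LinearMap.range μ) :=
  (Submodule.quotEquivOfEq _ _ (by
    ext ⟨x, z⟩
    simp [LinearMap.range_prodMap])).trans
    (((LinearMap.range μ).mkQ ∘ₗ LinearMap.fst A X Z).quotKerEquivOfSurjective
      ((Submodule.mkQ_surjective _).comp Prod.fst_surjective))

/-- Every map from the source of a CM-preenvelope to `Z` factors through the preenvelope. -/
def ExtendsAlongPreenvelopes (A : Type) [CommRing A] [IsLocalRing A] (d : ℕ) (Z : Type)
    [AddCommGroup Z] [Module A Z] : Prop :=
  ∀ (M X : Type) [AddCommGroup M] [Module A M] [AddCommGroup X] [Module A X] (μ : M →ₗ[A] X),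
    IsCMPreenvelope A d μ → ∀ f : M →ₗ[A] Z, ∃ g : X →ₗ[A] Z, g ∘ₗ μ = f

variable [IsLocalRing A] {d : ℕ}

lemma IsMCM.extendsAlongPreenvelopes {Z : Type} [AddCommGroup Z] [Module A Z]
    (hZ : IsMCM A d Z) : ExtendsAlongPreenvelopes A d Z :=
  fun _ _ _ _ _ _ _ hμ f => hμ.2 Z hZ f

lemma ExtendsAlongPreenvelopes.prod {Z W : Type} [AddCommGroup Z] [Module A Z]
    [AddCommGroup W] [Module A W] (hZ : ExtendsAlongPreenvelopes A d Z)
    (hW : ExtendsAlongPreenvelopes A d W) : ExtendsAlongPreenvelopes A d (Z × W) := by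
  intro M X _ _ _ _ μ hμ f
  obtain ⟨g, hg⟩ := hZ M X μ hμ (LinearMap.fst A Z W ∘ₗ f)
  obtain ⟨h, hh⟩ := hW M X μ hμ (LinearMap.snd A Z W ∘ₗ f)
  refine ⟨g.prod h, LinearMap.ext fun m => Prod.ext ?_ ?_⟩
  · exact LinearMap.congr_fun hg m
  · exact LinearMap.congr_fun hh m

lemma ExtendsAlongPreenvelopes.map_eq_zero {Z M X : Type} [AddCommGroup Z] [Module A Z]
    [AddCommGroup M] [Module A M] [AddCommGroup X] [Module A X]
    (hZ : ExtendsAlongPreenvelopes A d Z) {μ : M →ₗ[A] X} (hμ : IsCMPreenvelope A d μ)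
    (f : M →ₗ[A] Z) {m : M} (hm : μ m = 0) : f m = 0 := by
  obtain ⟨g, rfl⟩ := hZ M X μ hμ f
  simp [hm]

section StableIso

variable {M M' X X' Z Z' : Type} [AddCommGroup M] [Module A M] [AddCommGroup M'] [Module A M']
  [AddCommGroup X] [Module A X] [AddCommGroup X'] [Module A X'] [AddCommGroup Z] [Module A Z]
  [AddCommGroup Z'] [Module A Z']

lemma apply_eq_of_mem_ker (e : (M × Z) ≃ₗ[A] (M' × Z')) (hZ' : ExtendsAlongPreenvelopes A d Z')
    {μ : M →ₗ[A] X} {μ' : M' →ₗ[A] X'} (hμ : IsCMPreenvelope A d μ)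
    (hμ' : IsCMPreenvelope A d μ') {m : M} (hm : μ m = 0) :
    (e (m, 0)).2 = 0 ∧ μ' (e (m, 0)).1 = 0 :=
  ⟨hZ'.map_eq_zero hμ (LinearMap.snd A M' Z' ∘ₗ e.toLinearMap ∘ₗ LinearMap.inl A M Z) hm,
    hμ'.1.extendsAlongPreenvelopes.map_eq_zero hμ
      (μ' ∘ₗ LinearMap.fst A M' Z' ∘ₗ e.toLinearMap ∘ₗ LinearMap.inl A M Z) hm⟩

/-- Kernels of CM-preenvelopes only depend on the source up to summands along which
maps extend. -/
def kerEquivOfProdEquiv (e : (M × Z) ≃ₗ[A] (M' × Z')) (hZ : ExtendsAlongPreenvelopes A d Z)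
    (hZ' : ExtendsAlongPreenvelopes A d Z') {μ : M →ₗ[A] X} {μ' : M' →ₗ[A] X'}
    (hμ : IsCMPreenvelope A d μ) (hμ' : IsCMPreenvelope A d μ') :
    LinearMap.ker μ ≃ₗ[A] LinearMap.ker μ' :=
  LinearEquiv.ofLinearMap
    ((LinearMap.fst A M' Z' ∘ₗ e.toLinearMap ∘ₗ LinearMap.inl A M Z).restrict
      fun _ hm => (apply_eq_of_mem_ker e hZ' hμ hμ' hm).2)
    ((LinearMap.fst A M Z ∘ₗ e.symm.toLinearMap ∘ₗ LinearMap.inl A M' Z').restrict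
      fun _ hm => (apply_eq_of_mem_ker e.symm hZ hμ' hμ hm).2)
    (by
      ext ⟨m, hm⟩
      have h : ((e.symm (m, 0)).1, (0 : Z)) = e.symm (m, 0) :=
        Prod.ext rfl (apply_eq_of_mem_ker e.symm hZ hμ' hμ hm).1.symm
      change (e ((e.symm (m, 0)).1, 0)).1 = m
      rw [h, e.apply_symm_apply])
    (by
      ext ⟨m, hm⟩
      have h : ((e (m, 0)).1, (0 : Z')) = e (m, 0) :=
        Prod.ext rfl (apply_eq_of_mem_ker e hZ' hμ hμ' hm).1.symm
      change (e.symm ((e (m, 0)).1, 0)).1 = m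
      rw [h, e.symm_apply_apply])

lemma exists_comp_prodMap_id_eq {Y : Type} [AddCommGroup Y] [Module A Y]
    (hY : ExtendsAlongPreenvelopes A d Y) {μ : M →ₗ[A] X} (hμ : IsCMPreenvelope A d μ)
    (f : (M × Z) →ₗ[A] Y) :
    ∃ g : (X × Z) →ₗ[A] Y, g ∘ₗ μ.prodMap LinearMap.id = f := by
  obtain ⟨g, hg⟩ := hY M X μ hμ (f ∘ₗ LinearMap.inl A M Z)
  refine ⟨g.coprod (f ∘ₗ LinearMap.inr A M Z), LinearMap.prod_ext ?_ ?_⟩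
  · rw [← hg]
    ext m
    simp [← Prod.zero_eq_mk]
  · ext z
    simp

lemma nonempty_coker_prod_equiv (e : (M × Z) ≃ₗ[A] (M' × Z'))
    (hZ : ExtendsAlongPreenvelopes A d Z) (hZ' : ExtendsAlongPreenvelopes A d Z')
    {μ : M →ₗ[A] X} {μ' : M' →ₗ[A] X'} (hμ : IsCMPreenvelope A d μ)
    (hμ' : IsCMPreenvelope A d μ') :
    Nonempty (((X ⧸ LinearMap.range μ) × (X' × Z')) ≃ₗ[A]
      ((X' ⧸ LinearMap.range μ') × (X × Z))) := by
  obtain ⟨g, hg⟩ := exists_comp_prodMap_id_eq (hμ'.1.extendsAlongPreenvelopes.prod hZ') hμ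
    (μ'.prodMap LinearMap.id ∘ₗ e.toLinearMap)
  obtain ⟨h, hh⟩ := exists_comp_prodMap_id_eq (hμ.1.extendsAlongPreenvelopes.prod hZ) hμ'
    (μ.prodMap LinearMap.id ∘ₗ e.symm.toLinearMap)
  have hh' : h ∘ₗ (μ'.prodMap LinearMap.id ∘ₗ e.toLinearMap) = μ.prodMap LinearMap.id := by
    rw [← LinearMap.comp_assoc, hh]
    ext <;> simp
  have hr : LinearMap.range (μ'.prodMap (LinearMap.id : Z' →ₗ[A] Z') ∘ₗ e.toLinearMap) =
      LinearMap.range (μ'.prodMap (LinearMap.id : Z' →ₗ[A] Z')) :=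
    LinearMap.range_comp_of_range_eq_top _ e.range
  exact ⟨((cokerProdMapIdEquiv Z μ).symm.prodCongr (LinearEquiv.refl A _)).trans
    ((cokerProdEquiv _ _ g h hg hh').trans
      (((Submodule.quotEquivOfEq _ _ hr).trans (cokerProdMapIdEquiv Z' μ')).prodCongr
        (LinearEquiv.refl A _)))⟩

end StableIso

end Preenvelope

/-- The cokernel of `μ^i` is `coker d^i`. -/
def cokerMuAtEquiv (R : Type) [CommRing R] (M : Type) [AddCommGroup M] [Module R M]
    (X : ℕ → ModuleCat.{0} R) (d0 : M →ₗ[R] ↥(X 0)) (dn : ∀ i, ↥(X i) →ₗ[R] ↥(X (i+1)))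
    (hc0 : LinearMap.range d0 ≤ LinearMap.ker (dn 0))
    (hc : ∀ i, LinearMap.range (dn i) ≤ LinearMap.ker (dn (i+1))) :
    ∀ i, (↥(X i) ⧸ LinearMap.range (muAt R M X d0 dn hc0 hc i)) ≃ₗ[R]
      cokerAt R M X d0 dn (i+1)
  | 0 => LinearEquiv.refl R (↥(X 0) ⧸ LinearMap.range d0)
  | 1 => Submodule.quotEquivOfEq _ (LinearMap.range (dn 0))
      (Submodule.range_liftQ (LinearMap.range d0) (dn 0) hc0)
  | (i+2) => Submodule.quotEquivOfEq _ (LinearMap.range (dn (i+1)))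
      (Submodule.range_liftQ (LinearMap.range (dn i)) (dn (i+1)) (hc i))

end

/-- over a Henselian CM local ring, the kernels of the induced maps of two
special proper CM-coresolutions of `M` are isomorphic. -/
theorem ker_unique (R : Type) [CommRing R] [IsNoetherianRing R] [HenselianLocalRing R]
    (d : ℕ) (hdim : ringKrullDim R = d) (hCM : (d : ℕ∞) ≤ rdepth R R)
    (ω : Type) [AddCommGroup ω] [Module R ω] (hω : IsCanonicalModule R d ω)
    (M : Type) [AddCommGroup M] [Module R M] [Module.Finite R M]
    (X : ℕ → ModuleCat.{0} R)
    (d0 : M →ₗ[R] ↥(X 0)) (dn : ∀ i, ↥(X i) →ₗ[R] ↥(X (i+1)))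
    (hc0 : LinearMap.range d0 ≤ LinearMap.ker (dn 0))
    (hc : ∀ i, LinearMap.range (dn i) ≤ LinearMap.ker (dn (i+1)))
    (hres : IsSpecialProperCMCoresolution R M X d0 dn hc0 hc d)
    (X' : ℕ → ModuleCat.{0} R)
    (d0' : M →ₗ[R] ↥(X' 0)) (dn' : ∀ i, ↥(X' i) →ₗ[R] ↥(X' (i+1)))
    (hc0' : LinearMap.range d0' ≤ LinearMap.ker (dn' 0))
    (hc' : ∀ i, LinearMap.range (dn' i) ≤ LinearMap.ker (dn' (i+1)))
    (hres' : IsSpecialProperCMCoresolution R M X' d0' dn' hc0' hc' d) :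
    ∀ i : ℕ, Nonempty
      (↥(LinearMap.ker (muAt R M X d0 dn hc0 hc i)) ≃ₗ[R]
        ↥(LinearMap.ker (muAt R M X' d0' dn' hc0' hc' i))) := by
  have key : ∀ i, ∃ Z Z' : ModuleCat.{0} R, ExtendsAlongPreenvelopes R d Z ∧
      ExtendsAlongPreenvelopes R d Z' ∧
      Nonempty ((cokerAt R M X d0 dn i × Z) ≃ₗ[R] (cokerAt R M X' d0' dn' i × Z')) := by
    intro i
    induction i with
    | zero =>
      have hX := (hres.1 0).extendsAlongPreenvelopes
      exact ⟨X 0, X 0, hX, hX, ⟨LinearEquiv.refl R (M × X 0)⟩⟩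
    | succ i ih =>
      obtain ⟨Z, Z', hZ, hZ', ⟨e⟩⟩ := ih
      obtain ⟨f⟩ := nonempty_coker_prod_equiv e hZ hZ' (hres.2 i).1 (hres'.2 i).1
      exact ⟨ModuleCat.of R (X' i × Z'), ModuleCat.of R (X i × Z),
        (hres'.1 i).extendsAlongPreenvelopes.prod hZ',
        (hres.1 i).extendsAlongPreenvelopes.prod hZ,
        ⟨((cokerMuAtEquiv R M X d0 dn hc0 hc i).symm.prodCongr (LinearEquiv.refl R _)).trans
          (f.trans ((cokerMuAtEquiv R M X' d0' dn' hc0' hc' i).prodCongr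
            (LinearEquiv.refl R _)))⟩⟩
  intro i
  obtain ⟨Z, Z', hZ, hZ', ⟨e⟩⟩ := key i
  exact ⟨kerEquivOfProdEquiv e hZ hZ' (hres.2 i).1 (hres'.2 i).1⟩
end

section
/- Suppose R is Henselian. Then for every finitely generated R-module M, the minimal proper CM-coresolution 0 → M → X⁰ → X¹ → ⋯ of M has length at most d; that is, X^i = 0 for all i > d. -/
open CategoryTheory

open scoped Pointwise

noncomputable section

namespace CMCoresolution

section Bridge

variable {R : Type} [CommRing R]

open ProjectiveResolution in
lemma extMk_smul {X Y : ModuleCat.{0} R} (P : ProjectiveResolution X) {n : ℕ} (r : R)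
    (f : P.complex.X n ⟶ Y) (m : ℕ) (hm : n + 1 = m) (hf : P.complex.d m n ≫ f = 0) :
    P.extMk (r • f) m hm (by simp [hf]) = r • P.extMk f m hm hf := by
  rw [Abelian.Ext.smul_eq_comp_mk₀, extMk_comp_mk₀]
  simp

lemma extMk_zero_degree_eq_zero_iff {X Y : ModuleCat.{0} R} (P : ProjectiveResolution X)
    (f : P.complex.X 0 ⟶ Y) (hf : P.complex.d 1 0 ≫ f = 0) :
    P.extMk f 1 rfl hf = 0 ↔ f = 0 := by
  constructor
  · intro h
    rw [← P.extEquivCohomologyClass.apply_eq_iff_eq,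
      ProjectiveResolution.extEquivCohomologyClass_extMk,
      ProjectiveResolution.extEquivCohomologyClass_zero,
      CochainComplex.HomComplex.CohomologyClass.mk_eq_zero_iff,
      CochainComplex.HomComplex.Cocycle.toSingleMk_mem_coboundaries_iff _ _ _ _ _ 1 (by lia)] at h
    obtain ⟨g, hg⟩ := h
    have : g = 0 := (P.cochainComplex.isZero_of_isStrictlyLE 0 1).eq_of_src _ _
    rw [this, Limits.comp_zero] at hg
    rw [← cancel_epi (P.cochainComplexXIso (-(0 : ℕ)) 0 rfl).hom, ← hg]
    simp
  · rintro rfl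
    simp

/-- Cocycles of degree `n` for a projective resolution, mapped to their classes in `Ext`. -/
def cocycleToExt {X Y : ModuleCat.{0} R} (P : ProjectiveResolution X) (n : ℕ) :
    LinearMap.ker ((P.complex.linearYonedaObj R Y).d n (n + 1)).hom →ₗ[R]
      Abelian.Ext X Y n where
  toFun f := P.extMk f.1 (n + 1) rfl f.2
  map_add' _ _ := (P.add_extMk _ _ _ _ _ _).symm
  map_smul' r _ := extMk_smul P r _ _ _ _

lemma cocycleToExt_surjective {X Y : ModuleCat.{0} R} (P : ProjectiveResolution X) (n : ℕ) :
    Function.Surjective (cocycleToExt (Y := Y) P n) := fun α ↦ by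
  obtain ⟨f, hf, h⟩ := P.extMk_surjective α (n + 1) rfl
  exact ⟨⟨f, hf⟩, h⟩

lemma cocycleToExt_eq_zero_iff {X Y : ModuleCat.{0} R} (P : ProjectiveResolution X) (i n : ℕ)
    (hi : (ComplexShape.up ℕ).prev n = i)
    (f : LinearMap.ker ((P.complex.linearYonedaObj R Y).d n (n + 1)).hom) :
    cocycleToExt P n f = 0 ↔ ∃ g, (P.complex.linearYonedaObj R Y).d i n g = f.1 := by
  cases n with
  | zero =>
    rw [CochainComplex.prev_nat_zero] at hi
    subst hi
    have h0 : (P.complex.linearYonedaObj R Y).d 0 0 = 0 :=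
      HomologicalComplex.shape _ _ _ (by simp)
    simp only [h0]
    refine (extMk_zero_degree_eq_zero_iff P _ f.2).trans ?_
    constructor
    · intro h
      exact ⟨0, h.symm⟩
    · rintro ⟨g, hg⟩
      exact hg.symm
  | succ n =>
    rw [CochainComplex.prev_nat_succ] at hi
    subst hi
    exact P.extMk_eq_zero_iff f.1 _ rfl f.2 n rfl

lemma nonempty_ext1_linearEquiv (n : ℕ) (M N : Type) [AddCommGroup M] [Module R M]
    [AddCommGroup N] [Module R N] :
    Nonempty (ext1 R n M N ≃ₗ[R] Abelian.Ext (ModuleCat.of R M) (ModuleCat.of R N) n) := by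
  let P := projectiveResolution (ModuleCat.of R M)
  let K := P.complex.linearYonedaObj R (ModuleCat.of R N)
  let i := (ComplexShape.up ℕ).prev n
  let S := K.sc' i n (n + 1)
  let e₁ : ext1 R n M N ≅ K.homology n := P.isoExt n _
  let e₂ : K.homology n ≅ S.homology :=
    ShortComplex.homologyMapIso (K.isoSc' i n (n + 1) rfl (by simp))
  let φ : LinearMap.ker S.g.hom →ₗ[R] Abelian.Ext (ModuleCat.of R M) (ModuleCat.of R N) n :=
    cocycleToExt P n
  have hφ : LinearMap.range S.moduleCatToCycles = LinearMap.ker φ := by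
    ext f
    refine Iff.trans ?_ (cocycleToExt_eq_zero_iff P i n rfl f).symm
    exact exists_congr fun g ↦ Subtype.ext_iff
  exact ⟨(e₁ ≪≫ e₂ ≪≫ S.moduleCatHomologyIso).toLinearEquiv ≪≫ₗ
    (Submodule.quotEquivOfEq _ _ hφ) ≪≫ₗ
    φ.quotKerEquivOfSurjective (cocycleToExt_surjective P n)⟩

end Bridge

section UnbundledExt

variable (R : Type) [CommRing R]

/-- `Ext^n_R(M, N)` for unbundled modules, in Mathlib's derived category model. -/
abbrev ExtM (M N : Type) [AddCommGroup M] [Module R M] [AddCommGroup N] [Module R N]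
    (n : ℕ) : Type :=
  Abelian.Ext (ModuleCat.of R M) (ModuleCat.of R N) n

variable {R}
variable {A B C X Y : Type} [AddCommGroup A] [Module R A] [AddCommGroup B] [Module R B]
  [AddCommGroup C] [Module R C] [AddCommGroup X] [Module R X] [AddCommGroup Y] [Module R Y]

/-- Degree zero `Ext` is `Hom`. -/
def homEquivExtM (A B : Type) [AddCommGroup A] [Module R A] [AddCommGroup B] [Module R B] :
    (A →ₗ[R] B) ≃ₗ[R] ExtM R A B 0 :=
  (ModuleCat.homLinearEquiv (S := R) (M := ModuleCat.of R A) (N := ModuleCat.of R B)).symm ≪≫ₗ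
    Abelian.Ext.linearEquiv₀.symm

lemma homEquivExtM_apply (f : A →ₗ[R] B) :
    homEquivExtM A B f = Abelian.Ext.mk₀ (ModuleCat.ofHom f) := rfl

/-- The map induced by `f` on `Ext` in the first variable. -/
def extPre (Y : Type) [AddCommGroup Y] [Module R Y] (f : A →ₗ[R] B) (n : ℕ) :
    ExtM R B Y n →ₗ[R] ExtM R A Y n :=
  Abelian.Ext.bilinearCompOfLinear R _ _ _ 0 n n (zero_add n)
    (Abelian.Ext.mk₀ (ModuleCat.ofHom f))

/-- The map induced by `f` on `Ext` in the second variable. -/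
def extPost (X : Type) [AddCommGroup X] [Module R X] (f : A →ₗ[R] B) (n : ℕ) :
    ExtM R X A n →ₗ[R] ExtM R X B n :=
  (Abelian.Ext.bilinearCompOfLinear R _ _ _ n 0 n (add_zero n)).flip
    (Abelian.Ext.mk₀ (ModuleCat.ofHom f))

lemma extPre_comp (f : A →ₗ[R] B) (g : B →ₗ[R] C) (n : ℕ) (x : ExtM R C Y n) :
    extPre Y (g ∘ₗ f) n x = extPre Y f n (extPre Y g n x) := by
  simp [extPre, Abelian.Ext.bilinearCompOfLinear]

lemma extPre_id (n : ℕ) (x : ExtM R A Y n) :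
    extPre Y (LinearMap.id : A →ₗ[R] A) n x = x := by
  simp [extPre, Abelian.Ext.bilinearCompOfLinear]

lemma extPost_comp (f : A →ₗ[R] B) (g : B →ₗ[R] C) (n : ℕ) (x : ExtM R X A n) :
    extPost X (g ∘ₗ f) n x = extPost X g n (extPost X f n x) := by
  simp [extPost, Abelian.Ext.bilinearCompOfLinear]

lemma extPost_id (n : ℕ) (x : ExtM R X A n) :
    extPost X (LinearMap.id : A →ₗ[R] A) n x = x := by
  simp [extPost, Abelian.Ext.bilinearCompOfLinear]

lemma extPre_smul_id (r : R) (n : ℕ) (x : ExtM R A Y n) :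
    extPre Y (r • (LinearMap.id : A →ₗ[R] A)) n x = r • x := by
  have : ModuleCat.ofHom (r • (LinearMap.id : A →ₗ[R] A)) = r • 𝟙 (ModuleCat.of R A) := rfl
  simp [extPre, Abelian.Ext.bilinearCompOfLinear, this, Abelian.Ext.mk₀_smul]

lemma extPre_homEquivExtM (f : A →ₗ[R] B) (g : B →ₗ[R] Y) :
    extPre Y f 0 (homEquivExtM B Y g) = homEquivExtM A Y (g ∘ₗ f) := by
  simp [extPre, Abelian.Ext.bilinearCompOfLinear, homEquivExtM_apply]

lemma extPost_add (f g : A →ₗ[R] B) (n : ℕ) (x : ExtM R X A n) :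
    extPost X (f + g) n x = extPost X f n x + extPost X g n x := by
  simp [extPost, Abelian.Ext.bilinearCompOfLinear, Abelian.Ext.mk₀_add]

/-- An isomorphism in the first variable induces an isomorphism on `Ext`. -/
def extPreEquiv (Y : Type) [AddCommGroup Y] [Module R Y] (e : A ≃ₗ[R] B) (n : ℕ) :
    ExtM R B Y n ≃ₗ[R] ExtM R A Y n :=
  LinearEquiv.ofLinearMap (extPre Y e.toLinearMap n) (extPre Y e.symm.toLinearMap n)
    (by ext x; simp [← extPre_comp, extPre_id]) (by ext x; simp [← extPre_comp, extPre_id])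

/-- An isomorphism in the second variable induces an isomorphism on `Ext`. -/
def extPostEquiv (X : Type) [AddCommGroup X] [Module R X] (e : A ≃ₗ[R] B) (n : ℕ) :
    ExtM R X A n ≃ₗ[R] ExtM R X B n :=
  LinearEquiv.ofLinearMap (extPost X e.toLinearMap n) (extPost X e.symm.toLinearMap n)
    (by ext x; simp [← extPost_comp, extPost_id]) (by ext x; simp [← extPost_comp, extPost_id])

/-- Short exact sequences `0 → A → B → C → 0` of modules. -/
structure IsSES (f : A →ₗ[R] B) (g : B →ₗ[R] C) : Prop where
  inj : Function.Injective f
  exact : Function.Exact f g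
  surj : Function.Surjective g

namespace IsSES

variable {f : A →ₗ[R] B} {g : B →ₗ[R] C} (h : IsSES f g)

include h

lemma shortExact :
    (ShortComplex.mk (ModuleCat.ofHom f) (ModuleCat.ofHom g)
      (by ext x; exact h.exact.apply_apply_eq_zero x)).ShortExact :=
  ModuleCat.shortComplex_shortExact _ h.exact h.inj h.surj

/-- The class of a short exact sequence in `Ext^1`. -/
def cls (h : IsSES f g) : ExtM R C A 1 := h.shortExact.extClass

/-- The connecting map on `Ext` in the first variable. -/
def preConn (h : IsSES f g) (Y : Type) [AddCommGroup Y] [Module R Y] (n : ℕ) :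
    ExtM R A Y n →ₗ[R] ExtM R C Y (n + 1) :=
  Abelian.Ext.bilinearCompOfLinear R _ _ _ 1 n (n + 1) (add_comm 1 n) h.cls

/-- The connecting map on `Ext` in the second variable. -/
def postConn (h : IsSES f g) (X : Type) [AddCommGroup X] [Module R X] (n : ℕ) :
    ExtM R X C n →ₗ[R] ExtM R X A (n + 1) :=
  (Abelian.Ext.bilinearCompOfLinear R _ _ _ n 1 (n + 1) rfl).flip h.cls

variable (Y) in
lemma pre_mid (n : ℕ) (x : ExtM R B Y n) (hx : extPre Y f n x = 0) :
    ∃ y, extPre Y g n y = x :=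
  Abelian.Ext.contravariant_sequence_exact₂ h.shortExact _ x hx

variable (Y) in
lemma pre_left (n : ℕ) (x : ExtM R A Y n) (hx : h.preConn Y n x = 0) :
    ∃ y, extPre Y f n y = x :=
  Abelian.Ext.contravariant_sequence_exact₁ h.shortExact _ x (add_comm 1 n) hx

variable (Y) in
lemma pre_right (n : ℕ) (x : ExtM R C Y (n + 1)) (hx : extPre Y g (n + 1) x = 0) :
    ∃ y, h.preConn Y n y = x :=
  Abelian.Ext.contravariant_sequence_exact₃ h.shortExact _ x hx (add_comm 1 n)

variable (X) in
lemma post_mid (n : ℕ) (x : ExtM R X B n) (hx : extPost X g n x = 0) :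
    ∃ y, extPost X f n y = x :=
  Abelian.Ext.covariant_sequence_exact₂ _ h.shortExact x hx

variable (X) in
lemma post_right (n : ℕ) (x : ExtM R X C n) (hx : h.postConn X n x = 0) :
    ∃ y, extPost X g n y = x :=
  Abelian.Ext.covariant_sequence_exact₃ _ h.shortExact x rfl hx

variable (X) in
lemma post_left (n : ℕ) (x : ExtM R X A (n + 1)) (hx : extPost X f (n + 1) x = 0) :
    ∃ y, h.postConn X n y = x :=
  Abelian.Ext.covariant_sequence_exact₁ _ h.shortExact x hx rfl

variable (Y) in
lemma subsingleton_pre_mid (n : ℕ) [Subsingleton (ExtM R A Y n)]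
    [Subsingleton (ExtM R C Y n)] : Subsingleton (ExtM R B Y n) :=
  subsingleton_of_forall_eq 0 fun x ↦ by
    obtain ⟨y, rfl⟩ := h.pre_mid Y n x (Subsingleton.elim _ _)
    rw [Subsingleton.elim y 0, map_zero]

variable (Y) in
lemma subsingleton_pre_left (n : ℕ) [Subsingleton (ExtM R B Y n)]
    [Subsingleton (ExtM R C Y (n + 1))] : Subsingleton (ExtM R A Y n) :=
  subsingleton_of_forall_eq 0 fun x ↦ by
    obtain ⟨y, rfl⟩ := h.pre_left Y n x (Subsingleton.elim _ _)
    rw [Subsingleton.elim y 0, map_zero]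

variable (Y) in
lemma subsingleton_pre_right (n : ℕ) [Subsingleton (ExtM R A Y n)]
    [Subsingleton (ExtM R B Y (n + 1))] : Subsingleton (ExtM R C Y (n + 1)) :=
  subsingleton_of_forall_eq 0 fun x ↦ by
    obtain ⟨y, rfl⟩ := h.pre_right Y n x (Subsingleton.elim _ _)
    rw [Subsingleton.elim y 0, map_zero]

variable (X) in
lemma subsingleton_post_mid (n : ℕ) [Subsingleton (ExtM R X A n)]
    [Subsingleton (ExtM R X C n)] : Subsingleton (ExtM R X B n) :=
  subsingleton_of_forall_eq 0 fun x ↦ by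
    obtain ⟨y, rfl⟩ := h.post_mid X n x (Subsingleton.elim _ _)
    rw [Subsingleton.elim y 0, map_zero]

variable (X) in
lemma subsingleton_post_left (n : ℕ) [Subsingleton (ExtM R X C n)]
    [Subsingleton (ExtM R X B (n + 1))] : Subsingleton (ExtM R X A (n + 1)) :=
  subsingleton_of_forall_eq 0 fun x ↦ by
    obtain ⟨y, rfl⟩ := h.post_left X n x (Subsingleton.elim _ _)
    rw [Subsingleton.elim y 0, map_zero]

variable (X) in
lemma subsingleton_post_right (n : ℕ) [Subsingleton (ExtM R X B n)]
    [Subsingleton (ExtM R X A (n + 1))] : Subsingleton (ExtM R X C n) :=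
  subsingleton_of_forall_eq 0 fun x ↦ by
    obtain ⟨y, rfl⟩ := h.post_right X n x (Subsingleton.elim _ _)
    rw [Subsingleton.elim y 0, map_zero]

lemma preConn_injective (n : ℕ) [Subsingleton (ExtM R B Y n)] :
    Function.Injective (h.preConn Y n) :=
  (injective_iff_map_eq_zero _).2 fun x hx ↦ by
    obtain ⟨y, rfl⟩ := h.pre_left Y n x hx
    rw [Subsingleton.elim y 0, map_zero]

lemma preConn_surjective (n : ℕ) [Subsingleton (ExtM R B Y (n + 1))] :
    Function.Surjective (h.preConn Y n) := fun x ↦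
  h.pre_right Y n x (Subsingleton.elim _ _)

lemma extPre_injective (n : ℕ) [Subsingleton (ExtM R C Y n)] :
    Function.Injective (extPre Y f n) :=
  (injective_iff_map_eq_zero _).2 fun x hx ↦ by
    obtain ⟨y, rfl⟩ := h.pre_mid Y n x hx
    rw [Subsingleton.elim y 0, map_zero]

lemma extPre_surjective (n : ℕ) [Subsingleton (ExtM R C Y (n + 1))] :
    Function.Surjective (extPre Y f n) := fun x ↦
  h.pre_left Y n x (Subsingleton.elim _ _)

/-- The map `Hom(A, Y) → Ext^1(C, Y)`. -/
def homConn (h : IsSES f g) (Y : Type) [AddCommGroup Y] [Module R Y] :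
    (A →ₗ[R] Y) →ₗ[R] ExtM R C Y 1 :=
  h.preConn Y 0 ∘ₗ (homEquivExtM A Y).toLinearMap

lemma exists_extension_of_homConn_eq_zero (u : A →ₗ[R] Y) (hu : h.homConn Y u = 0) :
    ∃ v : B →ₗ[R] Y, v ∘ₗ f = u := by
  obtain ⟨y, hy⟩ := h.pre_left Y 0 _ hu
  obtain ⟨v, rfl⟩ := (homEquivExtM B Y).surjective y
  refine ⟨v, (homEquivExtM A Y).injective ?_⟩
  rw [← extPre_homEquivExtM, hy]
  rfl

lemma homConn_comp (v : B →ₗ[R] Y) : h.homConn Y (v ∘ₗ f) = 0 := by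
  have : h.preConn Y 0 (extPre Y f 0 (homEquivExtM B Y v)) = 0 :=
    h.shortExact.extClass_comp_assoc _ (h := add_comm 1 0)
  rwa [extPre_homEquivExtM] at this

lemma exists_extension [Subsingleton (ExtM R C Y 1)] (u : A →ₗ[R] Y) :
    ∃ v : B →ₗ[R] Y, v ∘ₗ f = u :=
  h.exists_extension_of_homConn_eq_zero u (Subsingleton.elim _ _)

lemma homConn_surjective [Subsingleton (ExtM R B Y 1)] :
    Function.Surjective (h.homConn Y) :=
  (h.preConn_surjective 0).comp (homEquivExtM A Y).surjective

end IsSES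

end UnbundledExt

section Sequences

variable {R : Type} [CommRing R]
variable {A B C X Y : Type} [AddCommGroup A] [Module R A] [AddCommGroup B] [Module R B]
  [AddCommGroup C] [Module R C] [AddCommGroup X] [Module R X] [AddCommGroup Y] [Module R Y]

lemma isSES_of_surjective (f : A →ₗ[R] B) (hf : Function.Surjective f) :
    IsSES (LinearMap.ker f).subtype f :=
  ⟨Subtype.val_injective, LinearMap.exact_subtype_ker_map f, hf⟩

lemma isSES_of_injective (f : A →ₗ[R] B) (hf : Function.Injective f) :
    IsSES f (LinearMap.range f).mkQ :=
  ⟨hf, LinearMap.exact_map_mkQ_range f, Submodule.mkQ_surjective _⟩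

lemma isSES_submodule (p : Submodule R A) : IsSES p.subtype p.mkQ :=
  ⟨Subtype.val_injective, LinearMap.exact_subtype_mkQ p, Submodule.mkQ_surjective _⟩

lemma isSES_pi_succ (A : Type) [AddCommGroup A] [Module R A] (n : ℕ) :
    IsSES (LinearMap.single R (fun _ : Fin (n + 1) ↦ A) 0) (LinearMap.funLeft R A Fin.succ) where
  inj := fun _ _ h ↦ Pi.single_injective (M := fun _ : Fin (n + 1) ↦ A) 0 h
  exact := fun v ↦ by
    constructor
    · intro hv
      refine ⟨v 0, ?_⟩
      ext i
      refine Fin.cases (by simp) (fun j ↦ ?_) i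
      have := congrFun hv j
      simp only [LinearMap.funLeft_apply] at this
      simp [this]
    · rintro ⟨a, rfl⟩
      ext j
      simp [LinearMap.funLeft_apply]
  surj := fun v ↦ ⟨Fin.cons 0 v, by ext j; simp [LinearMap.funLeft_apply]⟩

lemma isSES_smul {x : R} (hx : IsSMulRegular A x) :
    IsSES (x • (LinearMap.id : A →ₗ[R] A)) (x • (⊤ : Submodule R A)).mkQ where
  inj := hx
  exact := by
    rw [LinearMap.exact_iff, Submodule.ker_mkQ]
    ext v
    simp [Submodule.mem_smul_pointwise_iff_exists]
  surj := Submodule.mkQ_surjective _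

lemma subsingleton_extM_of_subsingleton_right [Subsingleton A] (n : ℕ) :
    Subsingleton (ExtM R X A n) :=
  subsingleton_of_forall_eq 0 fun x ↦ by
    have h0 : (LinearMap.id : A →ₗ[R] A) = 0 := Subsingleton.elim _ _
    rw [← extPost_id n x, h0]
    have := extPost_add (0 : A →ₗ[R] A) 0 n x
    rw [add_zero] at this
    exact left_eq_add.1 this

lemma subsingleton_extM_pi_right (n m : ℕ) [Subsingleton (ExtM R X A n)] :
    Subsingleton (ExtM R X (Fin m → A) n) := by
  induction m with
  | zero => exact subsingleton_extM_of_subsingleton_right n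
  | succ m ih => exact (isSES_pi_succ A m).subsingleton_post_mid X n

instance [Module.Projective R A] (n : ℕ) : Subsingleton (ExtM R A Y (n + 1)) :=
  subsingleton_of_forall_eq 0 fun x ↦ Abelian.Ext.eq_zero_of_projective x

lemma finite_hom [IsNoetherianRing R] [Module.Finite R A] [Module.Finite R B] :
    Module.Finite R (A →ₗ[R] B) :=
  Module.Finite.equiv (homEquivExtM A B).symm

lemma subsingleton_extM_zero_iff :
    Subsingleton (ExtM R A B 0) ↔ Subsingleton (A →ₗ[R] B) :=
  (homEquivExtM A B).symm.toEquiv.subsingleton_congr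

lemma subsingleton_ext1_iff (n : ℕ) :
    Subsingleton (ext1 R n A B) ↔ Subsingleton (ExtM R A B n) :=
  (nonempty_ext1_linearEquiv n A B).some.toEquiv.subsingleton_congr

/-- Noetherian induction over finitely generated modules: to prove a property of a module one may
assume it for all proper quotients. -/
theorem quotient_induction [IsNoetherianRing R]
    {P : ∀ (N : Type) [AddCommGroup N] [Module R N], Prop}
    (step : ∀ (N : Type) [AddCommGroup N] [Module R N] [Module.Finite R N],
      (∀ (N' : Type) [AddCommGroup N'] [Module R N'] [Module.Finite R N'] (f : N →ₗ[R] N'),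
        Function.Surjective f → ¬ Function.Injective f → P N') → P N)
    (N : Type) [AddCommGroup N] [Module R N] [Module.Finite R N] : P N := by
  suffices H : ∀ K : Submodule R N, ∀ (N' : Type) [AddCommGroup N'] [Module R N']
      [Module.Finite R N'] (f : N →ₗ[R] N'), Function.Surjective f → LinearMap.ker f = K → P N' from
    H _ N LinearMap.id Function.surjective_id rfl
  intro K
  induction K using WellFoundedGT.induction with
  | ind K ih =>
    intro N' _ _ _ f hf hK
    refine step N' fun N'' _ _ _ g hg hg' ↦ ?_
    refine ih (LinearMap.ker (g ∘ₗ f)) ?_ N'' (g ∘ₗ f) (hg.comp hf) rfl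
    rw [← hK]
    refine lt_of_le_of_ne (LinearMap.ker_le_ker_comp f g) fun h ↦ hg' ?_
    refine (injective_iff_map_eq_zero g).2 fun y hy ↦ ?_
    obtain ⟨x, rfl⟩ := hf y
    have : x ∈ LinearMap.ker (g ∘ₗ f) := hy
    rwa [← h] at this

end Sequences

section Local

variable {R : Type} [CommRing R] [IsNoetherianRing R] [IsLocalRing R]
variable {A B C N Y : Type} [AddCommGroup A] [Module R A] [AddCommGroup B] [Module R B]
  [AddCommGroup C] [Module R C] [AddCommGroup N] [Module R N] [AddCommGroup Y] [Module R Y]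

local notation "𝔪" => IsLocalRing.maximalIdeal R
local notation "𝕜" => IsLocalRing.ResidueField R

/-- `DepthGE n N` states that the depth of `N` is at least `n`. -/
def DepthGE (R : Type) [CommRing R] [IsLocalRing R] (n : ℕ) (N : Type) [AddCommGroup N]
    [Module R N] : Prop :=
  ∀ i < n, Subsingleton (ExtM R (IsLocalRing.ResidueField R) N i)

omit [IsNoetherianRing R] in
lemma le_rdepth_iff (d : ℕ) : (d : ℕ∞) ≤ rdepth R N ↔ DepthGE R d N := by
  refine le_sInf_iff.trans ?_
  constructor
  · intro h i hi
    by_contra hn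
    have := h i ⟨i, rfl, fun hs ↦ hn ((subsingleton_ext1_iff i).1 hs)⟩
    exact absurd hi (not_lt.2 (by exact_mod_cast this))
  · rintro h _ ⟨m, rfl, hm⟩
    by_contra hlt
    rw [not_le] at hlt
    exact hm ((subsingleton_ext1_iff m).2 (h m (by exact_mod_cast hlt)))

omit [IsNoetherianRing R] in
lemma DepthGE.mono {m n : ℕ} (h : DepthGE R n N) (hmn : m ≤ n) : DepthGE R m N :=
  fun i hi ↦ h i (hi.trans_le hmn)

omit [IsNoetherianRing R] in
lemma DepthGE.equiv {n : ℕ} (h : DepthGE R n A) (e : A ≃ₗ[R] B) : DepthGE R n B := fun i hi ↦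
  have := h i hi
  (extPostEquiv 𝕜 e i).symm.toEquiv.subsingleton

omit [IsNoetherianRing R] in
lemma DepthGE.pi {n : ℕ} (h : DepthGE R n A) (m : ℕ) : DepthGE R n (Fin m → A) := fun i hi ↦
  have := h i hi
  subsingleton_extM_pi_right i m

namespace IsSES

variable {f : A →ₗ[R] B} {g : B →ₗ[R] C} (h : IsSES f g)

omit [IsNoetherianRing R]

include h

lemma depthGE_left {n : ℕ} (hB : DepthGE R (n + 1) B) (hC : DepthGE R n C) :
    DepthGE R (n + 1) A := fun i hi ↦ by
  have := hB i hi
  cases i with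
  | zero =>
    rw [subsingleton_extM_zero_iff] at this ⊢
    exact subsingleton_of_forall_eq 0 fun u ↦ by
      ext x
      exact h.inj (by simpa using LinearMap.congr_fun (Subsingleton.elim (f ∘ₗ u) 0) x)
  | succ i =>
    have := hC i (by lia)
    exact h.subsingleton_post_left _ i

lemma depthGE_right {n : ℕ} (hA : DepthGE R (n + 1) A) (hB : DepthGE R n B) :
    DepthGE R n C := fun i hi ↦
  have := hB i hi
  have := hA (i + 1) (by lia)
  h.subsingleton_post_right _ i

end IsSES

lemma exists_regular_or_injection (N : Type) [AddCommGroup N] [Module R N] [Module.Finite R N] :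
    (∃ x ∈ 𝔪, IsSMulRegular N x) ∨ ∃ f : 𝕜 →ₗ[R] N, Function.Injective f := by
  by_cases hs : Subsingleton (𝕜 →ₗ[R] N)
  · left
    obtain ⟨x, hx, hr⟩ := IsSMulRegular.subsingleton_linearMap_iff.1 hs
    refine ⟨x, ?_, hr⟩
    rwa [show Module.annihilator R 𝕜 = 𝔪 from Ideal.annihilator_quotient] at hx
  · right
    rw [not_subsingleton_iff_nontrivial] at hs
    obtain ⟨f, hf⟩ := exists_ne (0 : 𝕜 →ₗ[R] N)
    have : IsSimpleModule R 𝕜 := isSimpleModule_iff_quot_maximal.2 ⟨𝔪, inferInstance, ⟨.refl _ _⟩⟩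
    exact ⟨f, f.injective_or_eq_zero.resolve_right hf⟩

omit [IsNoetherianRing R] in
lemma subsingleton_of_smul_surjective [Module.Finite R N] {x : R} (hx : x ∈ 𝔪)
    (h : ∀ v : N, ∃ w : N, x • w = v) : Subsingleton N := by
  by_contra hn
  rw [not_subsingleton_iff_nontrivial] at hn
  refine Submodule.top_ne_pointwise_smul_of_mem_jacobson_annihilator (R := R) (M := N)
    (IsLocalRing.maximalIdeal_le_jacobson _ hx) (Eq.symm (eq_top_iff.2 fun v _ ↦ ?_))
  obtain ⟨w, rfl⟩ := h v
  exact (Submodule.mem_smul_pointwise_iff_exists ..).2 ⟨w, trivial, rfl⟩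

/-- If `x ∈ 𝔪` is regular on `N` and `Ext^{n+1}(N/xN, Y) = 0` then `Ext^n(N, Y) = 0`. -/
lemma subsingleton_extM_of_quotSMulTop [Module.Finite R N] [Module.Finite R Y] {x : R}
    (hx : x ∈ 𝔪) (hr : IsSMulRegular N x) (n : ℕ)
    [Subsingleton (ExtM R (QuotSMulTop x N) Y (n + 1))] : Subsingleton (ExtM R N Y n) := by
  refine subsingleton_of_smul_surjective hx fun v ↦ ?_
  obtain ⟨w, hw⟩ := (isSES_smul hr).extPre_surjective (Y := Y) n v
  exact ⟨w, by rwa [extPre_smul_id] at hw⟩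

omit [IsNoetherianRing R] in
lemma nontrivial_quotSMulTop [Module.Finite R N] [Nontrivial N] {x : R} (hx : x ∈ 𝔪) :
    Nontrivial (QuotSMulTop x N) := by
  by_contra hn
  rw [not_nontrivial_iff_subsingleton] at hn
  refine not_subsingleton N (subsingleton_of_smul_surjective hx fun v ↦ ?_)
  have hv : (x • (⊤ : Submodule R N)).mkQ v = 0 := hn.elim _ _
  rw [Submodule.mkQ_apply, Submodule.Quotient.mk_eq_zero,
    Submodule.mem_smul_pointwise_iff_exists] at hv
  obtain ⟨w, -, hw⟩ := hv
  exact ⟨w, hw⟩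

omit [IsNoetherianRing R] [IsLocalRing R] in
lemma not_injective_mkQ_smul [Nontrivial N] {x : R}
    (hr : IsSMulRegular N x) : ¬ Function.Injective (x • (⊤ : Submodule R N)).mkQ := fun hi ↦ by
  obtain ⟨v, hv⟩ := exists_ne (0 : N)
  refine hv (hr (?_ : x • v = x • 0))
  rw [smul_zero]
  refine hi ?_
  rw [map_zero, Submodule.mkQ_apply, Submodule.Quotient.mk_eq_zero]
  exact Submodule.smul_mem_pointwise_smul _ _ _ trivial

omit [IsNoetherianRing R] in
lemma not_injective_mkQ_range (f : 𝕜 →ₗ[R] N) (hf : Function.Injective f) :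
    ¬ Function.Injective (LinearMap.range f).mkQ := fun hi ↦ by
  have h1 : (LinearMap.range f).mkQ (f 1) = (LinearMap.range f).mkQ 0 := by
    rw [map_zero, Submodule.mkQ_apply, Submodule.Quotient.mk_eq_zero]
    exact ⟨1, rfl⟩
  exact one_ne_zero (hf ((hi h1).trans (map_zero f).symm))

end Local

section Vanishing

variable {R : Type} [CommRing R] [IsNoetherianRing R] [IsLocalRing R]

local notation "𝔪" => IsLocalRing.maximalIdeal R
local notation "𝕜" => IsLocalRing.ResidueField R

lemma subsingleton_extM_of_residueField {ω : Type} [AddCommGroup ω] [Module R ω]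
    [Module.Finite R ω] (n : ℕ) (hk : Subsingleton (ExtM R 𝕜 ω n))
    (h : ∀ (N : Type) [AddCommGroup N] [Module R N] [Module.Finite R N],
      Subsingleton (ExtM R N ω (n + 1)))
    (N : Type) [AddCommGroup N] [Module R N] [Module.Finite R N] :
    Subsingleton (ExtM R N ω n) := by
  refine quotient_induction (R := R) (P := fun N _ _ ↦ Subsingleton (ExtM R N ω n))
    (fun N _ _ _ ih ↦ ?_) N
  obtain ⟨x, hx, hr⟩ | ⟨f, hf⟩ := exists_regular_or_injection (R := R) N
  · have := h (QuotSMulTop x N)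
    exact subsingleton_extM_of_quotSMulTop hx hr n
  · have := ih _ _ (Submodule.mkQ_surjective _) (not_injective_mkQ_range f hf)
    exact (isSES_of_injective f hf).subsingleton_pre_mid ω n

lemma subsingleton_extM_residueField_of_supportDim_lt {ω : Type} [AddCommGroup ω] [Module R ω]
    (n : ℕ)
    (h : ∀ (N : Type) [AddCommGroup N] [Module R N] [Module.Finite R N],
      Subsingleton (ExtM R N ω (n + 1))) (s : ℕ) :
    ∀ (r : ℕ) (_ : s + r ≤ n) (N : Type) [AddCommGroup N] [Module R N] [Module.Finite R N]
      [Nontrivial N], Module.supportDim R N < s → (∀ i, r < i → Subsingleton (ExtM R N ω i)) →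
      Subsingleton (ExtM R 𝕜 ω n) := by
  induction s with
  | zero =>
    intro r _ N _ _ _ _ hN _
    obtain ⟨m, hm⟩ := WithBot.ne_bot_iff_exists.1 (Module.supportDim_ne_bot_of_nontrivial R N)
    rw [← hm] at hN
    exact absurd hN (not_lt.2 (WithBot.coe_le_coe.2 (zero_le (a := m))))
  | succ s ih =>
    intro r hr N _ _ _ _ hN hext
    obtain ⟨x, hx, hreg⟩ | ⟨f, hf⟩ := exists_regular_or_injection (R := R) N
    · have := nontrivial_quotSMulTop (R := R) (N := N) hx
      have hdim : Module.supportDim R (QuotSMulTop x N) < s := by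
        rw [← Module.supportDim_quotSMulTop_succ_eq_supportDim hreg hx] at hN
        refine lt_of_not_ge fun hge ↦ not_le.2 hN ?_
        push_cast
        gcongr
      refine ih (r + 1) (by lia) (QuotSMulTop x N) hdim ?_
      · rintro (_ | i) hi
        · lia
        · have := hext i (by lia)
          have := hext (i + 1) (by lia)
          exact (isSES_smul hreg).subsingleton_pre_right ω i
    · have := hext n (by lia)
      have := h (N ⧸ LinearMap.range f)
      exact (isSES_of_injective f hf).subsingleton_pre_left ω n

/-- Finite injective dimension and `dim R = d` force `Ext^n(-, ω) = 0` for `n > d`. -/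
lemma subsingleton_extM_of_dim_lt {ω : Type} [AddCommGroup ω] [Module R ω]
    [Module.Finite R ω] {d : ℕ} (hdim : ringKrullDim R = d) (hfid : HasFID R ω) (n : ℕ)
    (hn : d < n) (N : Type) [AddCommGroup N] [Module R N] [Module.Finite R N] :
    Subsingleton (ExtM R N ω n) := by
  obtain ⟨n₀, h₀⟩ := hfid
  suffices H : ∀ j n : ℕ, d < n → n₀ < n + j → ∀ (N : Type) [AddCommGroup N] [Module R N]
      [Module.Finite R N], Subsingleton (ExtM R N ω n) from H (n₀ + 1) n hn (by lia) N
  intro j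
  induction j with
  | zero =>
    intro n _ hn N _ _ _
    exact (subsingleton_ext1_iff n).1 (h₀ N n hn)
  | succ j ih =>
    intro n hn hj
    have h := fun N [AddCommGroup N] [Module R N] [Module.Finite R N] ↦
      ih (n + 1) (by lia) (by lia) N
    refine subsingleton_extM_of_residueField n ?_ h
    refine subsingleton_extM_residueField_of_supportDim_lt n h (d + 1) 0 (by lia) R ?_ ?_
    · rw [Module.supportDim_self_eq_ringKrullDim, hdim]
      exact_mod_cast d.lt_succ_self
    · rintro (_ | i) hi
      · lia
      · infer_instance

lemma exists_regular_of_depthGE {N : Type} [AddCommGroup N] [Module R N] [Module.Finite R N]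
    {n : ℕ} (h : DepthGE R (n + 1) N) : ∃ x ∈ 𝔪, IsSMulRegular N x := by
  refine (exists_regular_or_injection N).resolve_right ?_
  rintro ⟨f, hf⟩
  have := subsingleton_extM_zero_iff.1 (h 0 (by lia))
  rw [Subsingleton.elim f 0] at hf
  exact one_ne_zero (hf (a₁ := (1 : 𝕜)) (a₂ := 0) rfl)

/-- A module of depth at least `r` has `Ext^i(-, ω) = 0` for `i > d - r`. -/
lemma subsingleton_extM_of_depthGE {ω : Type} [AddCommGroup ω] [Module R ω]
    [Module.Finite R ω] {d : ℕ} (hdim : ringKrullDim R = d) (hfid : HasFID R ω) (r : ℕ) :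
    ∀ (i : ℕ) (_ : d < i + r) (N : Type) [AddCommGroup N] [Module R N] [Module.Finite R N],
      DepthGE R r N → Subsingleton (ExtM R N ω i) := by
  induction r with
  | zero => exact fun i hi N _ _ _ _ ↦ subsingleton_extM_of_dim_lt hdim hfid i hi N
  | succ r ih =>
    intro i hi N _ _ _ hN
    obtain ⟨x, hx, hreg⟩ := exists_regular_of_depthGE hN
    have := ih (i + 1) (by lia) (QuotSMulTop x N)
      ((isSES_smul hreg).depthGE_right hN (hN.mono (by lia)))
    exact subsingleton_extM_of_quotSMulTop hx hreg i

end Vanishing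

section Duality

variable {R : Type} [CommRing R]

lemma IsSES.dmap {A B C Y : Type} [AddCommGroup A] [Module R A] [AddCommGroup B] [Module R B]
    [AddCommGroup C] [Module R C] [AddCommGroup Y] [Module R Y] {f : A →ₗ[R] B} {g : B →ₗ[R] C}
    (h : IsSES f g) [Subsingleton (ExtM R C Y 1)] : IsSES (dmap R Y g) (dmap R Y f) where
  inj := fun u v huv ↦ by
    ext x
    obtain ⟨y, rfl⟩ := h.surj x
    exact LinearMap.congr_fun huv y
  exact := fun u ↦ by
    constructor
    · intro hu
      have hker : LinearMap.ker g ≤ LinearMap.ker u := fun x hx ↦ by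
        obtain ⟨a, rfl⟩ := (h.exact x).1 hx
        exact LinearMap.congr_fun hu a
      refine ⟨(LinearMap.ker g).liftQ u hker ∘ₗ
        (g.quotKerEquivOfSurjective h.surj).symm.toLinearMap, ?_⟩
      ext x
      have : (g.quotKerEquivOfSurjective h.surj).symm (g x) = Submodule.Quotient.mk x :=
        (LinearEquiv.symm_apply_eq _).2 rfl
      simp [_root_.dmap, this]
    · rintro ⟨v, rfl⟩
      ext a
      simp [_root_.dmap, h.exact.apply_apply_eq_zero]
  surj := fun u ↦ h.exists_extension u

variable [IsLocalRing R]

local notation "𝔪" => IsLocalRing.maximalIdeal R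
local notation "𝕜" => IsLocalRing.ResidueField R

lemma isMCM_iff {d : ℕ} {N : Type} [AddCommGroup N] [Module R N] :
    IsMCM R d N ↔ Module.Finite R N ∧ DepthGE R d N :=
  and_congr_right fun _ ↦ le_rdepth_iff d

lemma _root_.IsMCM.finite {d : ℕ} {N : Type} [AddCommGroup N] [Module R N] (h : IsMCM R d N) :
    Module.Finite R N := h.1

lemma _root_.IsMCM.depthGE {d : ℕ} {N : Type} [AddCommGroup N] [Module R N] (h : IsMCM R d N) :
    DepthGE R d N := (isMCM_iff.1 h).2

lemma IsSES.depthGE_kernel {A B C : Type} [AddCommGroup A] [Module R A] [AddCommGroup B]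
    [Module R B] [AddCommGroup C] [Module R C] {f : A →ₗ[R] B} {g : B →ₗ[R] C} (h : IsSES f g)
    {d : ℕ} (hB : DepthGE R d B) (hC : DepthGE R (d - 1) C) : DepthGE R d A := by
  cases d with
  | zero => exact fun i hi ↦ absurd hi (by lia)
  | succ d => exact h.depthGE_left hB hC

variable (R) in
/-- A canonical module over a Cohen-Macaulay local ring of dimension `d`, with depth conditions
rephrased through `DepthGE`. -/
structure CanonicalSetup (d : ℕ) (ω : Type) [AddCommGroup ω] [Module R ω] : Prop where
  dim : ringKrullDim R = d
  depth_self : DepthGE R d R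
  finite : Module.Finite R ω
  depth : DepthGE R d ω
  fid : HasFID R ω
  iso : Nonempty (ExtM R 𝕜 ω d ≃ₗ[R] 𝕜)

namespace CanonicalSetup

lemma of_isCanonicalModule {d : ℕ} {ω : Type} [AddCommGroup ω] [Module R ω]
    (hdim : ringKrullDim R = d) (hCM : (d : ℕ∞) ≤ rdepth R R) (hω : IsCanonicalModule R d ω) :
    CanonicalSetup R d ω where
  dim := hdim
  depth_self := (le_rdepth_iff d).1 hCM
  finite := hω.1.finite
  depth := hω.1.depthGE
  fid := hω.2.1
  iso := ⟨(nonempty_ext1_linearEquiv d _ _).some.symm ≪≫ₗ hω.2.2.some⟩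

variable {d : ℕ} {ω : Type} [AddCommGroup ω] [Module R ω] (S : CanonicalSetup R d ω)
variable {N : Type} [AddCommGroup N] [Module R N]

include S

lemma isMCM_free (n : ℕ) : IsMCM R d (Fin n → R) :=
  isMCM_iff.2 ⟨inferInstance, S.depth_self.pi n⟩

variable [IsNoetherianRing R]

lemma ext_eq_zero_of_depthGE [Module.Finite R N] {r : ℕ} (hN : DepthGE R r N) (i : ℕ)
    (hi : d < i + r) : Subsingleton (ExtM R N ω i) :=
  have := S.finite
  subsingleton_extM_of_depthGE S.dim S.fid r i hi N hN

lemma ext_isMCM (hN : IsMCM R d N) (i : ℕ) : Subsingleton (ExtM R N ω (i + 1)) :=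
  have := hN.finite
  S.ext_eq_zero_of_depthGE hN.depthGE (i + 1) (by lia)

lemma ext_eq_zero_of_lt [Module.Finite R N] (i : ℕ) (hi : d < i) :
    Subsingleton (ExtM R N ω i) :=
  S.ext_eq_zero_of_depthGE (r := 0) (fun _ h ↦ absurd h (by lia)) i hi

lemma isMCM_dual_free (n : ℕ) : IsMCM R d ((Fin n → R) →ₗ[R] ω) :=
  have := S.finite
  isMCM_iff.2 ⟨finite_hom, (S.depth.pi n).equiv ((Pi.basisFun R (Fin n)).constr R)⟩

lemma isMCM_kernel {n : ℕ} {p : (Fin n → R) →ₗ[R] N} (hp : Function.Surjective p)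
    (hN : IsMCM R d N) : IsMCM R d (LinearMap.ker p) :=
  isMCM_iff.2 ⟨inferInstance, (isSES_of_surjective p hp).depthGE_kernel (S.isMCM_free n).depthGE
    (hN.depthGE.mono (by lia))⟩

/-- The canonical dual of a maximal Cohen-Macaulay module is maximal Cohen-Macaulay. -/
lemma isMCM_dual (hN : IsMCM R d N) : IsMCM R d (N →ₗ[R] ω) := by
  have := S.finite
  have := hN.finite
  suffices H : ∀ j ≤ d, ∀ (N : Type) [AddCommGroup N] [Module R N], IsMCM R d N →
      DepthGE R j (N →ₗ[R] ω) from isMCM_iff.2 ⟨finite_hom, H d le_rfl N hN⟩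
  intro j
  induction j with
  | zero => exact fun _ _ _ _ _ i hi ↦ absurd hi (by lia)
  | succ j ih =>
    intro hj N _ _ hN
    have := hN.finite
    obtain ⟨n, p, hp⟩ := Module.Finite.exists_fin' R N
    have := S.ext_isMCM hN 0
    exact (isSES_of_surjective p hp).dmap.depthGE_left ((S.isMCM_dual_free n).depthGE.mono hj)
      (ih (by lia) _ (S.isMCM_kernel hp hN))

/-- A finitely generated module all of whose `Ext` groups into `ω` vanish is zero. -/
lemma subsingleton_of_ext (N : Type) [AddCommGroup N] [Module R N] [Module.Finite R N]
    (hN : ∀ i, Subsingleton (ExtM R N ω i)) : Subsingleton N := by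
  refine quotient_induction (R := R)
    (P := fun N _ _ ↦ (∀ i, Subsingleton (ExtM R N ω i)) → Subsingleton N)
    (fun N _ _ _ ih h ↦ ?_) N hN
  by_contra hns
  rw [not_subsingleton_iff_nontrivial] at hns
  obtain ⟨x, hx, hreg⟩ | ⟨f, hf⟩ := exists_regular_or_injection (R := R) N
  · have := nontrivial_quotSMulTop (R := R) (N := N) hx
    refine not_subsingleton (QuotSMulTop x N)
      (ih _ _ (isSES_smul hreg).surj (not_injective_mkQ_smul hreg) ?_)
    rintro (_ | i)
    · have := subsingleton_extM_zero_iff.1 (h 0)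
      refine subsingleton_extM_zero_iff.2 (subsingleton_of_forall_eq 0 fun u ↦ ?_)
      ext v
      exact LinearMap.congr_fun (Subsingleton.elim (u ∘ₗ Submodule.mkQ _) 0) v
    · have := h i
      have := h (i + 1)
      exact (isSES_smul hreg).subsingleton_pre_right ω i
  · have := h d
    have := S.ext_eq_zero_of_lt (N := N ⧸ LinearMap.range f) (d + 1) (by lia)
    have := (isSES_of_injective f hf).subsingleton_pre_left ω d
    exact not_subsingleton 𝕜 S.iso.some.symm.toEquiv.subsingleton

end CanonicalSetup

end Duality

section ResidueDuality

variable {R : Type} [CommRing R]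

lemma exists_descent {A B T : Type} [AddCommGroup A] [Module R A] [AddCommGroup B] [Module R B]
    [AddCommGroup T] [Module R T] {q : A →ₗ[R] T} (hq : Function.Surjective q) (f : A →ₗ[R] B)
    (hf : LinearMap.ker q ≤ LinearMap.ker f) : ∃ g : T →ₗ[R] B, g ∘ₗ q = f := by
  refine ⟨(LinearMap.ker q).liftQ f hf ∘ₗ (q.quotKerEquivOfSurjective hq).symm.toLinearMap, ?_⟩
  ext x
  have : (q.quotKerEquivOfSurjective hq).symm (q x) = Submodule.Quotient.mk x :=
    (LinearEquiv.symm_apply_eq _).2 rfl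
  simp [this]

lemma exists_isSES_of_ker_eq {A B C T : Type} [AddCommGroup A] [Module R A] [AddCommGroup B]
    [Module R B] [AddCommGroup C] [Module R C] [AddCommGroup T] [Module R T] {q : A →ₗ[R] T}
    {f : A →ₗ[R] B} {r : B →ₗ[R] C} (hq : Function.Surjective q)
    (hqf : LinearMap.ker q = LinearMap.ker f) (hfr : Function.Exact f r)
    (hr : Function.Surjective r) : ∃ g : T →ₗ[R] B, IsSES g r := by
  obtain ⟨g, rfl⟩ := exists_descent hq f hqf.le
  refine ⟨g, (injective_iff_map_eq_zero g).2 fun t ht ↦ ?_, fun y ↦ (hfr y).trans ?_, hr⟩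
  · obtain ⟨a, rfl⟩ := hq t
    exact hqf.ge (LinearMap.mem_ker.2 ht)
  · exact ⟨fun ⟨a, ha⟩ ↦ ⟨q a, ha⟩, fun ⟨t, ht⟩ ↦ (hq t).imp fun a ha ↦ by simp [ha, ht]⟩

variable [IsLocalRing R]

local notation "𝔪" => IsLocalRing.maximalIdeal R
local notation "𝕜" => IsLocalRing.ResidueField R

namespace CanonicalSetup

variable {d : ℕ} {ω : Type} [AddCommGroup ω] [Module R ω] (S : CanonicalSetup R d ω)
  [IsNoetherianRing R]

include S

/-- If `N` has grade `c + 1` with respect to `ω` and depth at least `d - c - 1`, and `T` is the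
cokernel of the dual of a free presentation of `N`, then `Ext^{i+1}(T, ω)` embeds into
`Ext^{i+1+c}(Ext^{c+1}(N, ω), ω)`. -/
lemma exists_injective_ext_transpose (W : Type) [AddCommGroup W] [Module R W] (c : ℕ) :
    ∀ (N : Type) [AddCommGroup N] [Module R N] [Module.Finite R N] (n₀ n₁ : ℕ)
      (p₀ : (Fin n₀ → R) →ₗ[R] N) (p₁ : (Fin n₁ → R) →ₗ[R] LinearMap.ker p₀)
      (T : Type) [AddCommGroup T] [Module R T] (q : ((Fin n₁ → R) →ₗ[R] ω) →ₗ[R] T),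
      Function.Surjective p₀ → Function.Surjective p₁ → Function.Surjective q →
      Function.Exact (dmap R ω ((LinearMap.ker p₀).subtype ∘ₗ p₁)) q →
      (∀ i < c, Subsingleton (ExtM R N ω (i + 1))) → DepthGE R (d - (c + 1)) N →
      (W ≃ₗ[R] ExtM R N ω (c + 1)) → ∀ i m, m = i + 1 + c →
      ∃ ψ : ExtM R T ω (i + 1) →ₗ[R] ExtM R W ω m, Function.Injective ψ := by
  have := S.finite
  induction c with
  | zero =>
    intro N _ _ _ n₀ n₁ p₀ p₁ T _ _ q hp₀ hp₁ hq hex _ hdep e i m hm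
    have h₀ := isSES_of_surjective p₀ hp₀
    have h₁ := isSES_of_surjective p₁ hp₁
    have hN₁ : IsMCM R d (LinearMap.ker p₀) :=
      isMCM_iff.2 ⟨inferInstance, h₀.depthGE_kernel (S.isMCM_free n₀).depthGE hdep⟩
    have := S.ext_isMCM hN₁ 0
    have hD := h₁.dmap (Y := ω)
    obtain ⟨r, hr⟩ := exists_descent hq (dmap R ω (LinearMap.ker p₁).subtype) (fun u hu ↦ by
      obtain ⟨v, rfl⟩ := (hex u).1 hu
      exact hD.exact.apply_apply_eq_zero (dmap R ω (LinearMap.ker p₀).subtype v))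
    obtain ⟨g, hg⟩ : ∃ g, IsSES g r := by
      refine exists_isSES_of_ker_eq (q := h₀.homConn ω) (f := q ∘ₗ dmap R ω p₁) (r := r)
        h₀.homConn_surjective ?_ ?_ ?_
      · ext v
        constructor
        · intro hv
          obtain ⟨u, rfl⟩ := h₀.exists_extension_of_homConn_eq_zero v hv
          exact (hex _).2 ⟨u, rfl⟩
        · intro hv
          obtain ⟨u, hu⟩ := (hex _).1 hv
          obtain rfl : u ∘ₗ (LinearMap.ker p₀).subtype = v := hD.inj hu
          exact h₀.homConn_comp u
      · intro t
        obtain ⟨u, rfl⟩ := hq t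
        rw [← LinearMap.comp_apply, hr, hD.exact u]
        constructor
        · rintro ⟨v, rfl⟩
          exact ⟨v, rfl⟩
        · rintro ⟨v, hv⟩
          have : q (u - dmap R ω p₁ v) = 0 := by rw [map_sub, sub_eq_zero]; exact hv.symm
          obtain ⟨w, hw⟩ := (hex _).1 this
          exact ⟨v + w ∘ₗ (LinearMap.ker p₀).subtype, by
            rw [map_add]; exact (sub_eq_iff_eq_add'.1 hw.symm).symm⟩
      · intro v
        obtain ⟨u, hu⟩ := hD.surj v
        exact ⟨q u, by rw [← hu, ← hr]; rfl⟩
    have := S.ext_isMCM (S.isMCM_dual (S.isMCM_kernel hp₁ hN₁)) i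
    subst hm
    exact ⟨extPre ω (g ∘ₗ e.toLinearMap) (i + 1), by
      have := (extPreEquiv ω e (i + 1)).injective.comp (hg.extPre_injective (Y := ω) (i + 1))
      refine fun x y hxy ↦ this ?_
      rw [extPre_comp, extPre_comp] at hxy
      exact hxy⟩
  | succ c ih =>
    intro N _ _ _ n₀ n₁ p₀ p₁ T _ _ q hp₀ hp₁ hq hex hext hdep e i m hm
    have h₀ := isSES_of_surjective p₀ hp₀
    have h₁ := isSES_of_surjective p₁ hp₁
    obtain ⟨n₂, p₂, hp₂⟩ := Module.Finite.exists_fin' R (LinearMap.ker p₁)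
    set t := dmap R ω ((LinearMap.ker p₁).subtype ∘ₗ p₂) with ht
    obtain ⟨g, hg⟩ : ∃ g, IsSES g (LinearMap.range t).mkQ := by
      refine exists_isSES_of_ker_eq (q := q) (f := t) hq ?_ (LinearMap.exact_map_mkQ_range t)
        (Submodule.mkQ_surjective _)
      have := hext 0 (by lia)
      ext u
      rw [LinearMap.mem_ker, hex u]
      constructor
      · rintro ⟨v, rfl⟩
        refine LinearMap.mem_ker.2 (LinearMap.ext fun x ↦ ?_)
        have : p₁ (p₂ x) = 0 := (p₂ x).2
        simp [ht, dmap, this]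
      · intro hu
        obtain ⟨v, rfl⟩ := exists_descent hp₁ u fun x hx ↦ by
          obtain ⟨y, hy⟩ := hp₂ ⟨x, hx⟩
          have := LinearMap.congr_fun hu y
          simpa [ht, dmap, hy] using this
        obtain ⟨w, rfl⟩ := h₀.exists_extension v
        exact ⟨w, rfl⟩
    have e' : W ≃ₗ[R] ExtM R (LinearMap.ker p₀) ω (c + 1) :=
      e ≪≫ₗ (LinearEquiv.ofBijective (h₀.preConn ω (c + 1))
        ⟨h₀.preConn_injective _, h₀.preConn_surjective _⟩).symm
    obtain ⟨ψ, hψ⟩ := ih (LinearMap.ker p₀) n₁ n₂ p₁ p₂ _ (LinearMap.range t).mkQ hp₁ hp₂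
      (Submodule.mkQ_surjective _) (LinearMap.exact_map_mkQ_range t)
      (fun j hj ↦ by
        have := hext (j + 1) (by lia)
        exact h₀.subsingleton_pre_left ω (j + 1))
      (h₀.depthGE_kernel ((S.isMCM_free n₀).depthGE.mono (by lia)) (hdep.mono (by lia)))
      e' (i + 1) m (by lia)
    have := S.ext_isMCM (S.isMCM_dual_free n₂) i
    exact ⟨ψ ∘ₗ hg.preConn ω (i + 1), hψ.comp (hg.preConn_injective (i + 1))⟩

end CanonicalSetup

end ResidueDuality

section EndomorphismRing

variable {R : Type} [CommRing R] [IsLocalRing R]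

local notation "𝔪" => IsLocalRing.maximalIdeal R
local notation "𝕜" => IsLocalRing.ResidueField R

lemma exists_residueField_map {N : Type} [AddCommGroup N] [Module R N] (v : N)
    (hv : ∀ r ∈ 𝔪, r • v = 0) : ∃ u : 𝕜 →ₗ[R] N, u 1 = v :=
  ⟨Submodule.liftQ 𝔪 (LinearMap.toSpanSingleton R N v) hv, one_smul R v⟩

lemma exists_generator_of_ker_le {E : Type} [AddCommGroup E] [Module R E] [Module.Finite R E]
    (ψ : E →ₗ[R] 𝕜) (hψ : LinearMap.ker ψ ≤ 𝔪 • ⊤) : ∃ e : E, ∀ x, ∃ r : R, r • e = x := by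
  obtain ⟨e, he⟩ : ∃ e, ∀ x, ∃ r : R, ψ x = r • ψ e := by
    by_cases h : ∀ x, ψ x = 0
    · exact ⟨0, fun x ↦ ⟨0, by simp [h]⟩⟩
    · push Not at h
      obtain ⟨e, he⟩ := h
      refine ⟨e, fun x ↦ ?_⟩
      obtain ⟨r, hr⟩ := IsLocalRing.residue_surjective (ψ x / ψ e)
      exact ⟨r, by rw [Algebra.smul_def, IsLocalRing.ResidueField.algebraMap_eq, hr,
        div_mul_cancel₀ _ he]⟩
  refine ⟨e, fun x ↦ Submodule.mem_span_singleton.1 ?_⟩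
  refine Submodule.le_of_le_smul_of_le_jacobson_bot (I := 𝔪) (N := R ∙ e) (N' := ⊤)
    Module.Finite.fg_top (IsLocalRing.maximalIdeal_le_jacobson _) (fun y _ ↦ ?_)
    (Submodule.mem_top : x ∈ ⊤)
  obtain ⟨r, hr⟩ := he y
  exact Submodule.mem_sup.2 ⟨r • e, Submodule.smul_mem _ r (Submodule.mem_span_singleton_self e),
    y - r • e, hψ (by simp [hr]), by abel⟩

lemma factor_mem_smul_top {n : ℕ} (a : Fin n → R) (ha : ∀ i, a i ∈ 𝔪) {N : Type}
    [AddCommGroup N] [Module R N] (β : (Fin n → N) →ₗ[R] N) :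
    β ∘ₗ LinearMap.pi (fun i ↦ a i • LinearMap.id) ∈ (𝔪 • ⊤ : Submodule R (N →ₗ[R] N)) := by
  have : β ∘ₗ LinearMap.pi (fun i ↦ a i • LinearMap.id) =
      ∑ i, a i • (β ∘ₗ LinearMap.single R (fun _ ↦ N) i) := by
    ext v
    have : (fun i ↦ a i • v) = ∑ i, a i • (Pi.single i v : Fin n → N) := by
      ext j
      simp [Finset.sum_apply, Pi.single_apply]
    change β (fun i ↦ a i • v) = _
    simp only [this, map_sum, map_smul, LinearMap.sum_apply, LinearMap.smul_apply]
    rfl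
  rw [this]
  exact Submodule.sum_mem _ fun i _ ↦ Submodule.smul_mem_smul (ha i) trivial

namespace CanonicalSetup

variable {d : ℕ} {ω : Type} [AddCommGroup ω] [Module R ω] (S : CanonicalSetup R d ω)
  [IsNoetherianRing R]

include S

omit [IsNoetherianRing R] in
lemma isMCM : IsMCM R d ω := isMCM_iff.2 ⟨S.finite, S.depth⟩

lemma exists_residue_functional :
    ∃ ψ : (ω →ₗ[R] ω) →ₗ[R] 𝕜, LinearMap.ker ψ ≤ 𝔪 • ⊤ := by
  have := S.finite
  obtain ⟨n, a, ha⟩ := Submodule.fg_iff_exists_fin_generating_family.1 (IsNoetherian.noetherian 𝔪)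
  have hmem : ∀ i, a i ∈ 𝔪 := fun i ↦ ha ▸ Submodule.subset_span (Set.mem_range_self i)
  set α : ω →ₗ[R] (Fin n → ω) := LinearMap.pi fun i ↦ a i • LinearMap.id with hα
  have hker : ∀ v, α v = 0 → ∀ r ∈ 𝔪, r • v = 0 := fun v hv r hr ↦ by
    have : 𝔪 ≤ LinearMap.ker (LinearMap.toSpanSingleton R ω v) := by
      rw [← ha, Submodule.span_le]
      rintro _ ⟨i, rfl⟩
      exact congrFun hv i
    exact this hr
  obtain ⟨ε⟩ := S.iso
  cases d with
  | zero =>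
    obtain ⟨u, hu⟩ := (homEquivExtM 𝕜 ω ≪≫ₗ ε).surjective 1
    refine ⟨(homEquivExtM 𝕜 ω ≪≫ₗ ε).toLinearMap ∘ₗ LinearMap.lcomp R ω u, fun φ hφ ↦ ?_⟩
    have hφu : φ ∘ₗ u = 0 := (homEquivExtM 𝕜 ω ≪≫ₗ ε).map_eq_zero_iff.1 hφ
    obtain ⟨g, hg⟩ := exists_descent α.surjective_rangeRestrict φ fun v hv ↦ by
      obtain ⟨w, rfl⟩ := exists_residueField_map v (hker v (congrArg Subtype.val hv))
      obtain ⟨r, hr⟩ := IsLocalRing.residue_surjective ((homEquivExtM 𝕜 ω ≪≫ₗ ε) w)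
      have : w = r • u := (homEquivExtM 𝕜 ω ≪≫ₗ ε).injective (by
        rw [map_smul, hu, ← hr, Algebra.smul_def, mul_one]; rfl)
      have h1 := LinearMap.congr_fun hφu 1
      rw [this, LinearMap.mem_ker, LinearMap.smul_apply, map_smul, show φ (u 1) = 0 from h1, smul_zero]
    have := S.ext_eq_zero_of_lt (N := (Fin n → ω) ⧸ LinearMap.range α) 1 (by lia)
    obtain ⟨β, rfl⟩ := (isSES_submodule (LinearMap.range α)).exists_extension g
    rw [← hg]
    exact factor_mem_smul_top a hmem β
  | succ c =>
    have hinj : Function.Injective α := (injective_iff_map_eq_zero _).2 fun v hv ↦ by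
      obtain ⟨w, rfl⟩ := exists_residueField_map v (hker v hv)
      have := subsingleton_extM_zero_iff.1 (S.depth 0 (by lia))
      rw [Subsingleton.elim w 0, LinearMap.zero_apply]
    have h := isSES_of_injective α hinj
    set e : (Fin n → ω) ≃ₗ[R] ((Fin n → R) →ₗ[R] ω) := (Pi.basisFun R (Fin n)).constr R
    set s : (Fin n → R) →ₗ[R] R := Fintype.linearCombination R a with hs
    have hes : ∀ v, e (α v) = LinearMap.toSpanSingleton R ω v ∘ₗ s := fun v ↦ by
      refine (Pi.basisFun R (Fin n)).ext fun i ↦ ?_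
      rw [Module.Basis.constr_basis]
      simp [hs, α, Fintype.linearCombination_apply_single]
    set p₀ : (Fin 1 → R) →ₗ[R] 𝕜 := Algebra.linearMap R 𝕜 ∘ₗ LinearMap.proj 0 with hp₀
    have hmem₀ : ∀ x : Fin 1 → R, x ∈ LinearMap.ker p₀ ↔ x 0 ∈ 𝔪 := fun x ↦
      IsLocalRing.residue_eq_zero_iff _
    have hrange : LinearMap.range s = 𝔪 := by
      rw [hs, Fintype.range_linearCombination, ha]
    set p₁ : (Fin n → R) →ₗ[R] LinearMap.ker p₀ := LinearMap.codRestrict _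
      (LinearMap.pi fun _ ↦ s) fun x ↦ (hmem₀ _).2 (hrange ▸ LinearMap.mem_range_self s x) with hp₁
    obtain ⟨ψ, hψ⟩ := S.exists_injective_ext_transpose 𝕜 c 𝕜 1 n p₀ p₁
      ((Fin n → ω) ⧸ LinearMap.range α) ((LinearMap.range α).mkQ ∘ₗ e.symm.toLinearMap)
      (fun x ↦ by
        obtain ⟨r, hr⟩ := IsLocalRing.residue_surjective x
        exact ⟨fun _ ↦ r, hr⟩)
      (fun x ↦ by
        have : x.1 0 ∈ LinearMap.range s := hrange ▸ (hmem₀ _).1 x.2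
        obtain ⟨y, hy⟩ := this
        refine ⟨y, Subtype.ext (funext fun j ↦ ?_)⟩
        rw [Subsingleton.elim j 0]
        exact hy)
      ((Submodule.mkQ_surjective _).comp e.symm.surjective)
      (fun u ↦ by
        rw [LinearMap.comp_apply, ← LinearMap.mem_ker, Submodule.ker_mkQ]
        constructor
        · rintro ⟨v, hv⟩
          rw [LinearEquiv.coe_coe, LinearEquiv.eq_symm_apply, hes] at hv
          refine ⟨LinearMap.toSpanSingleton R ω v ∘ₗ LinearMap.proj 0, ?_⟩
          rw [← hv]
          rfl
        · rintro ⟨w, rfl⟩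
          refine ⟨w fun _ ↦ 1, ?_⟩
          rw [LinearEquiv.coe_coe, LinearEquiv.eq_symm_apply, hes]
          refine LinearMap.ext fun x ↦ ?_
          have : (fun _ ↦ s x : Fin 1 → R) = s x • fun _ ↦ 1 := by ext; simp
          change s x • w (fun _ ↦ 1) = w (fun _ ↦ s x)
          rw [this, map_smul])
      (fun i hi ↦ S.depth (i + 1) (by lia)) (fun i hi ↦ absurd hi (by lia)) ε.symm 0 (c + 1)
      (by lia)
    refine ⟨ε.toLinearMap ∘ₗ ψ ∘ₗ h.homConn ω, fun φ hφ ↦ ?_⟩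
    have : h.homConn ω φ = 0 := hψ (ε.injective (by simpa using hφ))
    obtain ⟨β, rfl⟩ := h.exists_extension_of_homConn_eq_zero φ this
    exact factor_mem_smul_top a hmem β

/-- Every endomorphism of the canonical module is a homothety. -/
lemma exists_smul_id_eq (φ : ω →ₗ[R] ω) : ∃ r : R, r • LinearMap.id = φ := by
  have := S.finite
  have : Module.Finite R (ω →ₗ[R] ω) := finite_hom
  obtain ⟨ψ, hψ⟩ := S.exists_residue_functional
  obtain ⟨e, he⟩ := exists_generator_of_ker_le ψ hψ
  obtain ⟨r, hr⟩ := he LinearMap.id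
  obtain ⟨s, rfl⟩ := he φ
  have hu : IsUnit r := by
    by_contra hr'
    have : Subsingleton ω := subsingleton_of_smul_surjective (x := r) hr' fun v ↦
      ⟨e v, LinearMap.congr_fun hr v⟩
    have := subsingleton_extM_of_subsingleton_right (R := R) (A := ω) (X := 𝕜) d
    obtain ⟨ε⟩ := S.iso
    exact not_subsingleton 𝕜 ε.symm.toEquiv.subsingleton
  obtain ⟨t, ht⟩ := hu.exists_left_inv
  exact ⟨s * t, by rw [mul_smul, ← hr, smul_smul t r, ht, one_smul]⟩

/-- The canonical module is faithful. -/
lemma eq_zero_of_smul_eq_zero (r : R) (hr : ∀ v : ω, r • v = 0) : r = 0 := by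
  set l : R →ₗ[R] (ω →ₗ[R] ω) := LinearMap.toSpanSingleton R _ LinearMap.id
  have hl := isSES_of_surjective l S.exists_smul_id_eq
  have hE := S.isMCM_dual S.isMCM
  have := S.ext_isMCM hE 0
  have hI : IsMCM R d (LinearMap.ker l) :=
    isMCM_iff.2 ⟨inferInstance, hl.depthGE_kernel S.depth_self (hE.depthGE.mono (by lia))⟩
  have : Subsingleton (LinearMap.ker l) := S.subsingleton_of_ext _ <| by
    rintro (_ | i)
    · refine subsingleton_extM_zero_iff.2 (subsingleton_of_forall_eq 0 fun u ↦ ?_)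
      obtain ⟨v, rfl⟩ := hl.exists_extension u
      ext x
      have h1 : (x : R) • v 1 = 0 := LinearMap.congr_fun x.2 (v 1)
      rwa [← map_smul, smul_eq_mul, mul_one] at h1
    · exact S.ext_isMCM hI i
  exact congrArg Subtype.val
    (Subsingleton.elim (⟨r, LinearMap.ext hr⟩ : LinearMap.ker l) 0)

end CanonicalSetup

end EndomorphismRing

section Reflexivity

variable {R : Type} [CommRing R] [IsLocalRing R]

namespace CanonicalSetup

variable {d : ℕ} {ω : Type} [AddCommGroup ω] [Module R ω] (S : CanonicalSetup R d ω)
  [IsNoetherianRing R]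

include S

lemma bijective_deltaMap_free (n : ℕ) : Function.Bijective (deltaMap R ω (Fin n → R)) := by
  constructor
  · refine (injective_iff_map_eq_zero _).2 fun x hx ↦ funext fun i ↦ ?_
    exact S.eq_zero_of_smul_eq_zero _ fun v ↦
      LinearMap.congr_fun hx (LinearMap.toSpanSingleton R ω v ∘ₗ LinearMap.proj i)
  · intro Φ
    set e : (Fin n → ω) ≃ₗ[R] ((Fin n → R) →ₗ[R] ω) := (Pi.basisFun R (Fin n)).constr R with he
    choose x hx using fun i ↦ S.exists_smul_id_eq
      (Φ ∘ₗ e.toLinearMap ∘ₗ LinearMap.single R (fun _ ↦ ω) i)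
    refine ⟨x, LinearMap.ext fun u ↦ ?_⟩
    obtain ⟨w, rfl⟩ := e.surjective u
    have hw : Φ (e w) = ∑ i, x i • w i := by
      conv_lhs => rw [← Finset.univ_sum_single w, map_sum, map_sum]
      exact Finset.sum_congr rfl fun i _ ↦ (LinearMap.congr_fun (hx i) (w i)).symm
    rw [hw, he]
    change (Pi.basisFun R (Fin n)).constr R w x = _
    simp [Module.Basis.constr_apply_fintype]

/-- Maximal Cohen-Macaulay modules are reflexive with respect to the canonical dual. -/
lemma bijective_deltaMap {Z : Type} [AddCommGroup Z] [Module R Z] (hZ : IsMCM R d Z) :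
    Function.Bijective (deltaMap R ω Z) := by
  have key : ∀ (Z : Type) [AddCommGroup Z] [Module R Z], IsMCM R d Z →
      ∃ (n : ℕ) (p : (Fin n → R) →ₗ[R] Z), Function.Surjective p ∧
        IsSES (dmap R ω (dmap R ω (LinearMap.ker p).subtype)) (dmap R ω (dmap R ω p)) := by
    intro Z _ _ hZ
    have := hZ.finite
    obtain ⟨n, p, hp⟩ := Module.Finite.exists_fin' R Z
    have := S.ext_isMCM hZ 0
    have := S.ext_isMCM (S.isMCM_dual (S.isMCM_kernel hp hZ)) 0
    exact ⟨n, p, hp, (isSES_of_surjective p hp).dmap.dmap⟩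
  have surj : ∀ (Z : Type) [AddCommGroup Z] [Module R Z], IsMCM R d Z →
      Function.Surjective (deltaMap R ω Z) := by
    intro Z _ _ hZ Φ
    obtain ⟨n, p, hp, h⟩ := key Z hZ
    obtain ⟨Ψ, rfl⟩ := h.surj Φ
    obtain ⟨x, rfl⟩ := (S.bijective_deltaMap_free n).2 Ψ
    exact ⟨p x, rfl⟩
  refine ⟨(injective_iff_map_eq_zero _).2 fun z hz ↦ ?_, surj Z hZ⟩
  obtain ⟨n, p, hp, h⟩ := key Z hZ
  obtain ⟨x, rfl⟩ := hp z
  obtain ⟨Ψ, hΨ⟩ := (h.exact (deltaMap R ω _ x)).1 hz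
  obtain ⟨y, rfl⟩ := surj _ (S.isMCM_kernel hp hZ) Ψ
  obtain rfl : (y : Fin n → R) = x := (S.bijective_deltaMap_free n).1 hΨ
  exact y.2

variable {C X : Type} [AddCommGroup C] [Module R C] [AddCommGroup X] [Module R X]
  {μ : C →ₗ[R] X}

omit [IsNoetherianRing R] in
lemma isSES_dmap_of_preenvelope (hμ : IsCMPreenvelope R d μ) :
    IsSES (dmap R ω (LinearMap.range μ).mkQ) (dmap R ω μ) where
  inj := fun u v huv ↦ by
    ext x
    exact LinearMap.congr_fun huv x
  exact := fun u ↦ by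
    constructor
    · intro hu
      obtain ⟨v, rfl⟩ := exists_descent (LinearMap.range μ).mkQ_surjective u (by
        rw [Submodule.ker_mkQ]
        rintro _ ⟨c, rfl⟩
        exact LinearMap.congr_fun hu c)
      exact ⟨v, rfl⟩
    · rintro ⟨v, rfl⟩
      ext c
      have : (LinearMap.range μ).mkQ (μ c) = 0 := by simp
      exact (congrArg v this).trans (map_zero v)
  surj := hμ.2 ω S.isMCM

lemma isMCM_dual_of_preenvelope (hμ : IsCMPreenvelope R d μ) (hC : DepthGE R d (C →ₗ[R] ω)) :
    IsMCM R d (C →ₗ[R] ω) :=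
  have := (S.isMCM_dual hμ.1).finite
  isMCM_iff.2 ⟨Module.Finite.of_surjective _ (S.isSES_dmap_of_preenvelope hμ).surj, hC⟩

/-- If the canonical dual of `C` is maximal Cohen-Macaulay, then the cokernel of a CM-envelope
of `C` has zero canonical dual. -/
lemma subsingleton_dual_coker (hμ : IsCMEnvelope R d μ) (hC : IsMCM R d (C →ₗ[R] ω)) :
    Subsingleton ((X ⧸ LinearMap.range μ) →ₗ[R] ω) := by
  obtain ⟨g, hg⟩ := hμ.1.2 _ (S.isMCM_dual hC) (deltaMap R ω C)
  set e := LinearEquiv.ofBijective _ (S.bijective_deltaMap hμ.1.1) with he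
  set s := e.symm.toLinearMap ∘ₗ dmap R ω (dmap R ω μ) with hs
  have hsδ : ∀ c, s (deltaMap R ω C c) = μ c := fun c ↦ e.symm_apply_eq.2 rfl
  have hsg : Function.Bijective (s ∘ₗ g) := hμ.2 _ <| LinearMap.ext fun c ↦ by
    rw [LinearMap.comp_apply, LinearMap.comp_apply, ← LinearMap.comp_apply g, hg, hsδ]
  have hvan : ∀ u : ((C →ₗ[R] ω) →ₗ[R] ω) →ₗ[R] ω, u ∘ₗ deltaMap R ω C = 0 → u = 0 := by
    intro u hu
    obtain ⟨v, rfl⟩ := (S.bijective_deltaMap hC).2 u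
    obtain rfl : v = 0 := LinearMap.ext fun c ↦ LinearMap.congr_fun hu c
    exact map_zero _
  refine subsingleton_of_forall_eq 0 fun u ↦ ?_
  have hu := hvan (u ∘ₗ (LinearMap.range μ).mkQ ∘ₗ s) <| LinearMap.ext fun c ↦ by
    have : (LinearMap.range μ).mkQ (s (deltaMap R ω C c)) = 0 := by simp [hsδ]
    exact (congrArg u this).trans (map_zero u)
  ext x
  obtain ⟨y, rfl⟩ := hsg.2 x
  exact LinearMap.congr_fun hu (g y)

lemma subsingleton_envelope (hμ : IsCMEnvelope R d μ) [Subsingleton (C →ₗ[R] ω)] :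
    Subsingleton X := by
  have h0 : μ = 0 := LinearMap.ext fun c ↦ (S.bijective_deltaMap hμ.1.1).1 <|
    LinearMap.ext fun u ↦ by
      have := LinearMap.congr_fun (Subsingleton.elim (u ∘ₗ μ) 0) c
      simpa [deltaMap] using this
  have := hμ.2 0 (by simp [h0])
  exact ⟨fun x y ↦ this.1 rfl⟩

end CanonicalSetup

end Reflexivity

section Coresolution

variable (R : Type) [CommRing R] (M : Type) [AddCommGroup M] [Module R M]
  (X : ℕ → ModuleCat.{0} R) (d0 : M →ₗ[R] ↥(X 0)) (dn : ∀ i, ↥(X i) →ₗ[R] ↥(X (i+1)))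
  (hc0 : LinearMap.range d0 ≤ LinearMap.ker (dn 0))
  (hc : ∀ i, LinearMap.range (dn i) ≤ LinearMap.ker (dn (i+1)))

/-- The cokernel of `μ^i` is the source of `μ^{i+1}`. -/
lemma nonempty_cokerAt_succ_equiv : ∀ i, Nonempty
    ((X i ⧸ LinearMap.range (muAt R M X d0 dn hc0 hc i)) ≃ₗ[R] cokerAt R M X d0 dn (i + 1))
  | 0 => ⟨LinearEquiv.refl R _⟩
  | 1 => ⟨Submodule.quotEquivOfEq _ (LinearMap.range (dn 0)) (Submodule.range_liftQ _ _ _)⟩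
  | i + 2 => ⟨Submodule.quotEquivOfEq _ (LinearMap.range (dn (i + 1)))
      (Submodule.range_liftQ _ _ _)⟩

end Coresolution

end CMCoresolution

end

open CMCoresolution

/-- over a Henselian CM local ring, the minimal proper CM-coresolution of any
finitely generated module has length at most `d`: `X^i = 0` for `i > d`. -/
theorem minimal_proper_cm_coresolution_length_le (R : Type) [CommRing R] [IsNoetherianRing R]
    [HenselianLocalRing R]
    (d : ℕ) (hdim : ringKrullDim R = d) (hCM : (d : ℕ∞) ≤ rdepth R R)
    (ω : Type) [AddCommGroup ω] [Module R ω] (hω : IsCanonicalModule R d ω)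
    (M : Type) [AddCommGroup M] [Module R M] [Module.Finite R M]
    (X : ℕ → ModuleCat.{0} R)
    (d0 : M →ₗ[R] ↥(X 0)) (dn : ∀ i, ↥(X i) →ₗ[R] ↥(X (i+1)))
    (hc0 : LinearMap.range d0 ≤ LinearMap.ker (dn 0))
    (hc : ∀ i, LinearMap.range (dn i) ≤ LinearMap.ker (dn (i+1)))
    (hres : IsMinimalProperCMCoresolution R M X d0 dn hc0 hc d) :
    ∀ i : ℕ, d < i → Subsingleton ↥(X i) := by
  have S := CanonicalSetup.of_isCanonicalModule hdim hCM hω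
  have e := fun i ↦ (nonempty_cokerAt_succ_equiv R M X d0 dn hc0 hc i).some
  have henv := hres.2
  have hdepth : ∀ i ≤ d, DepthGE R i (cokerAt R M X d0 dn i →ₗ[R] ω) := by
    intro i
    induction i with
    | zero => exact fun _ j hj ↦ absurd hj (by lia)
    | succ i ih =>
      intro hi
      exact ((S.isSES_dmap_of_preenvelope (henv i).1).depthGE_left
        ((S.isMCM_dual (henv i).1.1).depthGE.mono hi) (ih (by lia))).equiv
        ((e i).congrLeft ω R)
  have hzero : ∀ j, Subsingleton (cokerAt R M X d0 dn (d + 1 + j) →ₗ[R] ω) := by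
    intro j
    induction j with
    | zero =>
      have := S.subsingleton_dual_coker (henv d)
        (S.isMCM_dual_of_preenvelope (henv d).1 (hdepth d le_rfl))
      exact ((e d).congrLeft ω R).symm.toEquiv.subsingleton
    | succ j ih =>
      have := S.subsingleton_envelope (henv (d + 1 + j))
      have : Subsingleton (cokerAt R M X d0 dn (d + 1 + j + 1)) :=
        (e (d + 1 + j)).symm.toEquiv.subsingleton
      exact subsingleton_of_forall_eq 0 fun u ↦ LinearMap.ext fun x ↦ by
        rw [Subsingleton.elim x 0, map_zero, map_zero]
  intro i hi
  obtain ⟨j, rfl⟩ := Nat.exists_eq_add_of_le hi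
  have := hzero j
  exact S.subsingleton_envelope (henv (d + 1 + j))
end
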